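/- arXiv:0905.0530 — 6 statements merged into one kernel-verified Lean document; each statement's English description precedes it below -/
import Mathlib

section
/- Let Ω₁ ⊂ Ω₂ ⊂ ℝⁿ be bounded open sets with smooth boundaries, and let G : Ω̄₂ × Ω̄₂ → ℝ be a Green kernel for the Dirichlet Laplacian on Ω₂, i.e.: G is symmetric (G(x,y) = G(y,x)), continuous off the diagonal; for each fixed x ∈ Ω₂ the function y ↦ G(x,y) is harmonic on Ω₂ ∖ {x} and vanishes for y ∈ ∂Ω₂; and for every v ∈ L²(Ω₂) the potential w(y) = ∫_{Ω₂} G(x,y) v(x) dx belongs to H²(Ω₂) ∩ H¹₀(Ω₂) and satisfies −Δw = v on Ω₂. Then the set { x ↦ ∫_{Ω₂} G(x,y) a(y) dy : a ∈ C^∞(Ω̄₂), supp a ⊂ Ω̄₂ ∖ Ω₁ }, restricted to Ω₁, is dense with respect to the L²(Ω₁) topology in the subspace of functions u ∈ C^∞(Ω̄₁) that are harmonic on Ω₁ and satisfy u = 0 on ∂Ω₁ ∩ ∂Ω₂. -/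
open MeasureTheory

noncomputable section

/-- The Laplacian of `u : ℝⁿ → ℝ`, as the sum of the second partial derivatives. -/
def lap {n : ℕ} (u : EuclideanSpace ℝ (Fin n) → ℝ) (x : EuclideanSpace ℝ (Fin n)) : ℝ :=
  ∑ i, iteratedFDeriv ℝ 2 u x ![EuclideanSpace.single i 1, EuclideanSpace.single i 1]

/-- `u` is harmonic on `s`: twice continuously differentiable with vanishing Laplacian. -/
def IsHarmonicOn {n : ℕ} (u : EuclideanSpace ℝ (Fin n) → ℝ)
    (s : Set (EuclideanSpace ℝ (Fin n))) : Prop :=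
  ContDiffOn ℝ 2 u s ∧ ∀ x ∈ s, lap u x = 0

/-- `Ω` has smooth boundary: near each boundary point there is a smooth local defining
function with nonvanishing differential. -/
def HasSmoothBoundary {n : ℕ} (Ω : Set (EuclideanSpace ℝ (Fin n))) : Prop :=
  ∀ x ∈ frontier Ω, ∃ (U : Set (EuclideanSpace ℝ (Fin n))) (ρ : EuclideanSpace ℝ (Fin n) → ℝ),
    IsOpen U ∧ x ∈ U ∧ ContDiffOn ℝ (⊤ : ℕ∞) ρ U ∧ (∀ y ∈ U, fderiv ℝ ρ y ≠ 0) ∧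
    Ω ∩ U = {y ∈ U | ρ y < 0} ∧ frontier Ω ∩ U = {y ∈ U | ρ y = 0}


/-- A test function on `Ω`: smooth and compactly supported inside `Ω`. -/
def IsTest {n : ℕ} (Ω : Set (EuclideanSpace ℝ (Fin n))) (φ : EuclideanSpace ℝ (Fin n) → ℝ) :
    Prop :=
  ContDiff ℝ (⊤ : ℕ∞) φ ∧ HasCompactSupport φ ∧ tsupport φ ⊆ Ω

/-- `g` is the `i`-th weak partial derivative of `w` on `Ω`. -/
def HasWeakPartial {n : ℕ} (Ω : Set (EuclideanSpace ℝ (Fin n)))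
    (w g : EuclideanSpace ℝ (Fin n) → ℝ) (i : Fin n) : Prop :=
  ∀ φ, IsTest Ω φ →
    ∫ x in Ω, w x * fderiv ℝ φ x (EuclideanSpace.single i 1) = - ∫ x in Ω, g x * φ x

/-- `w ∈ H¹(Ω)`: `w` is in `L²(Ω)` and has weak partial derivatives in `L²(Ω)`. -/
def MemH1 {n : ℕ} (Ω : Set (EuclideanSpace ℝ (Fin n))) (w : EuclideanSpace ℝ (Fin n) → ℝ) :
    Prop :=
  MemLp w 2 (volume.restrict Ω) ∧
    ∀ i, ∃ g, MemLp g 2 (volume.restrict Ω) ∧ HasWeakPartial Ω w g i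

/-- `w ∈ H²(Ω)`: `w` is in `L²(Ω)` and has weak partial derivatives in `H¹(Ω)`. -/
def MemH2 {n : ℕ} (Ω : Set (EuclideanSpace ℝ (Fin n))) (w : EuclideanSpace ℝ (Fin n) → ℝ) :
    Prop :=
  MemLp w 2 (volume.restrict Ω) ∧ ∀ i, ∃ g, MemH1 Ω g ∧ HasWeakPartial Ω w g i

/-- `w ∈ H¹₀(Ω)`: `w ∈ H¹(Ω)` is an `H¹`-limit of test functions on `Ω`. -/
def MemH10 {n : ℕ} (Ω : Set (EuclideanSpace ℝ (Fin n))) (w : EuclideanSpace ℝ (Fin n) → ℝ) :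
    Prop :=
  ∃ (g : Fin n → EuclideanSpace ℝ (Fin n) → ℝ) (φ : ℕ → EuclideanSpace ℝ (Fin n) → ℝ),
    MemLp w 2 (volume.restrict Ω) ∧
    (∀ i, MemLp (g i) 2 (volume.restrict Ω) ∧ HasWeakPartial Ω w (g i) i) ∧
    (∀ k, IsTest Ω (φ k)) ∧
    Filter.Tendsto
      (fun k => ∫ x in Ω, ((w x - φ k x) ^ 2 +
        ∑ i, (g i x - fderiv ℝ (φ k) x (EuclideanSpace.single i 1)) ^ 2))
      Filter.atTop (nhds 0)

section helpers
open Filter Topology Set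
open scoped Pointwise

variable {E : Type*} [NormedAddCommGroup E] [NormedSpace ℝ E] [FiniteDimensional ℝ E]

lemma rg_good_ball {ρ : E → ℝ} {U : Set E} (hU : IsOpen U) (hρ : ContDiffOn ℝ 1 ρ U) {p : E}
    (hp : p ∈ U) (hd : fderiv ℝ ρ p ≠ 0) :
    ∃ (ν : E) (r : ℝ), 0 < r ∧ Metric.ball p r ⊆ U ∧ ∀ x ∈ Metric.ball p r, ∀ t : ℝ, 0 < t →
      x + t • ν ∈ Metric.ball p r → ρ x < ρ (x + t • ν) := by
  obtain ⟨ν, hν⟩ : ∃ ν, 0 < fderiv ℝ ρ p ν := by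
    by_contra! h
    apply hd
    ext v
    have h1 := h v
    have h2 := h (-v)
    simp only [map_neg] at h2
    simp; linarith
  have hc : ContinuousOn (fun x => fderiv ℝ ρ x ν) U :=
    (hρ.continuousOn_fderiv_of_isOpen hU le_rfl).clm_apply continuousOn_const
  have hn : {x | x ∈ U ∧ 0 < fderiv ℝ ρ x ν} ∈ 𝓝 p := by
    have := (hc.continuousAt (hU.mem_nhds hp)).eventually (lt_mem_nhds hν)
    filter_upwards [hU.mem_nhds hp, this] with x hx hx' using ⟨hx, hx'⟩
  obtain ⟨r, hr, hb⟩ := Metric.mem_nhds_iff.1 hn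
  refine ⟨ν, r, hr, fun x hx => (hb hx).1, ?_⟩
  intro x hx t ht hxt
  have hmem : ∀ s ∈ Icc 0 t, x + s • ν ∈ Metric.ball p r := by
    intro s hs
    have hconv := (convex_ball p r)
    have := hconv.add_smul_mem hx hxt (t := s / t) ⟨div_nonneg hs.1 ht.le, (div_le_one ht).2 hs.2⟩
    rwa [smul_smul, div_mul_cancel₀ _ ht.ne'] at this
  have hder : ∀ s ∈ Icc 0 t, HasDerivAt (fun s : ℝ => ρ (x + s • ν)) (fderiv ℝ ρ (x + s • ν) ν) s := by
    intro s hs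
    have h1 : HasFDerivAt ρ (fderiv ℝ ρ (x + s • ν)) (x + s • ν) :=
      ((hρ.contDiffAt (hU.mem_nhds (hb (hmem s hs)).1)).differentiableAt (by simp)).hasFDerivAt
    have h2 : HasDerivAt (fun s : ℝ => x + s • ν) ν s := by
      simpa using ((hasDerivAt_id s).smul_const ν).const_add x
    exact h1.comp_hasDerivAt s h2
  have hm : StrictMonoOn (fun s : ℝ => ρ (x + s • ν)) (Icc 0 t) := by
    apply strictMonoOn_of_deriv_pos (convex_Icc 0 t)
    · intro s hs
      exact (hder s hs).continuousAt.continuousWithinAt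
    · intro s hs
      have hs' := interior_subset hs
      rw [(hder s hs').deriv]
      exact (hb (hmem s hs')).2
  have := hm (left_mem_Icc.2 ht.le) (right_mem_Icc.2 ht.le) ht
  simpa using this

lemma rg_null_level [MeasurableSpace E] [BorelSpace E] (μ : Measure E) [μ.IsAddHaarMeasure]
    {ρ : E → ℝ} {U : Set E} (hU : IsOpen U) (hρ : ContDiffOn ℝ 1 ρ U) :
    μ {x | x ∈ U ∧ ρ x = 0 ∧ fderiv ℝ ρ x ≠ 0} = 0 := by
  apply measure_null_of_locally_null
  rintro p ⟨hpU, -, hd⟩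
  obtain ⟨ν, r, hr, hb, hmono⟩ := rg_good_ball hU hρ hpU hd
  set δ := r / (4 * (‖ν‖ + 1)) with hδ
  have hν0 : 0 ≤ ‖ν‖ := norm_nonneg _
  have hδ0 : 0 < δ := by positivity
  have hδν : δ * ‖ν‖ ≤ r / 4 := by
    rw [hδ, div_mul_eq_mul_div, div_le_div_iff₀ (by positivity) (by positivity)]
    nlinarith
  have hsub : Metric.closedBall p (r / 2) ⊆ Metric.ball p r :=
    Metric.closedBall_subset_ball (by linarith)
  set T := Metric.closedBall p (r / 2) ∩ ρ ⁻¹' {0} with hT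
  have hTc : IsClosed T :=
    (hρ.continuousOn.mono (hsub.trans hb)).preimage_isClosed_of_isClosed
      Metric.isClosed_closedBall isClosed_singleton
  have key : ∀ x ∈ T, ∀ y ∈ T, ∀ s : ℝ, 0 < s → s ≤ δ → y ≠ x + s • ν := by
    rintro x hx y hy s hs hsd rfl
    have := hmono x (hsub hx.1) s hs (hsub hy.1)
    have h1 : ρ x = 0 := hx.2
    have h2 : ρ (x + s • ν) = 0 := hy.2
    linarith
  have hanti : ∀ m k : ℕ, m < k → δ / (k + 1) < δ / (m + 1) := by
    intro m k hmk
    have : (m : ℝ) < k := by exact_mod_cast hmk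
    exact div_lt_div_of_pos_left hδ0 (by positivity) (by linarith)
  have hle : ∀ m : ℕ, δ / (m + 1) ≤ δ := fun m => div_le_self hδ0.le (by linarith [(Nat.cast_nonneg m : (0:ℝ) ≤ m)])
  have hpos : ∀ m : ℕ, 0 < δ / (m + 1 : ℝ) := fun m => by positivity
  have hdisj : ∀ m k : ℕ, m < k →
      Disjoint (({(δ / (m + 1 : ℝ)) • ν} : Set E) + T) (({(δ / (k + 1 : ℝ)) • ν} : Set E) + T) := by
    intro m k hmk
    rw [Set.disjoint_left]
    intro z hz hz'
    rw [Set.singleton_add] at hz hz'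
    obtain ⟨x, hx, rfl⟩ := hz
    obtain ⟨y, hy, hxy⟩ := hz'
    simp only at hxy
    refine key x hx y hy (δ / (m + 1) - δ / (k + 1)) (sub_pos.2 (hanti m k hmk)) ?_ ?_
    · linarith [hle m, hpos k]
    · rw [sub_smul]
      have : y = (δ / (m + 1 : ℝ)) • ν + x - (δ / (k + 1 : ℝ)) • ν := by rw [← hxy]; abel
      rw [this]; abel
  refine ⟨T ∩ {x | x ∈ U ∧ ρ x = 0 ∧ fderiv ℝ ρ x ≠ 0}, ?_, ?_⟩
  · rw [mem_nhdsWithin]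
    refine ⟨Metric.ball p (r / 2), Metric.isOpen_ball, Metric.mem_ball_self (by linarith), ?_⟩
    rintro x ⟨hx, hx'⟩
    exact ⟨⟨Metric.ball_subset_closedBall hx, hx'.2.1⟩, hx'⟩
  · refine measure_mono_null Set.inter_subset_left ?_
    refine Measure.addHaar_eq_zero_of_disjoint_translates μ (fun m : ℕ => (δ / (m + 1 : ℝ)) • ν)
      ?_ ?_ hTc.measurableSet
    · refine (Metric.isBounded_closedBall (x := (0:E)) (r := δ * ‖ν‖)).subset ?_
      rintro _ ⟨m, rfl⟩
      simp only [mem_closedBall_zero_iff, norm_smul, Real.norm_eq_abs, abs_of_pos (hpos m)]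
      exact mul_le_mul_of_nonneg_right (hle m) hν0
    · intro m k hmk
      rcases lt_or_gt_of_ne hmk with h | h
      · exact hdisj m k h
      · exact (hdisj k m h).symm

lemma rg_cutoff {K O : Set E} (hK : IsCompact K) (hO : IsOpen O) (hKO : K ⊆ O) :
    ∃ η : E → ℝ, ContDiff ℝ (⊤ : ℕ∞) η ∧ HasCompactSupport η ∧ tsupport η ⊆ O ∧
      ∀ x ∈ K, η x = 1 := by
  obtain ⟨L, hL, hKL, hLO⟩ := exists_compact_between hK hO hKO
  obtain ⟨f, hf, -, hs, h1⟩ := exists_contMDiff_support_eq_eq_one_iff (modelWithCornersSelf ℝ E)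
    (n := ⊤) isOpen_interior hK.isClosed hKL
  have hts : tsupport f ⊆ L := by
    rw [tsupport, hs]; exact closure_minimal interior_subset hL.isClosed
  exact ⟨f, hf.contDiff, hL.of_isClosed_subset (isClosed_tsupport _) hts, hts.trans hLO,
    fun x hx => (h1 x).1 hx⟩

end helpers

section bdry
open Filter Topology Set

lemma rg_inward {n : ℕ} {Ω : Set (EuclideanSpace ℝ (Fin n))} (ho : IsOpen Ω)
    (hs : HasSmoothBoundary Ω) (p : EuclideanSpace ℝ (Fin n)) (hp : p ∈ closure Ω) :
    ∃ (V : Set (EuclideanSpace ℝ (Fin n))) (ν : EuclideanSpace ℝ (Fin n)) (δ : ℝ),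
      IsOpen V ∧ p ∈ V ∧ 0 < δ ∧ ∀ x ∈ V, x ∈ closure Ω → ∀ t : ℝ, 0 < t → t ≤ δ →
        x - t • ν ∈ Ω := by
  by_cases hpo : p ∈ Ω
  · exact ⟨Ω, 0, 1, ho, hpo, one_pos, fun x hx _ t _ _ => by simpa using hx⟩
  have hpf : p ∈ frontier Ω := by rw [ho.frontier_eq]; exact ⟨hp, hpo⟩
  obtain ⟨U, ρ, hU, hpU, hρ, hd, h1, h2⟩ := hs p hpf
  obtain ⟨ν, r, hr, hb, hmono⟩ := rg_good_ball hU (hρ.of_le (by exact_mod_cast le_top)) hpU (hd p hpU)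
  have hν0 : 0 ≤ ‖ν‖ := norm_nonneg _
  refine ⟨Metric.ball p (r / 2), ν, r / (4 * (‖ν‖ + 1)), Metric.isOpen_ball,
    Metric.mem_ball_self (by linarith), by positivity, ?_⟩
  intro x hx hxc t ht htd
  have htν : t * ‖ν‖ ≤ r / 4 := by
    rw [le_div_iff₀ (by positivity)] at htd
    nlinarith
  have hxr : x ∈ Metric.ball p r := Metric.ball_subset_ball (by linarith) hx
  have hyr : x - t • ν ∈ Metric.ball p r := by
    rw [Metric.mem_ball, dist_eq_norm] at hx ⊢
    have : ‖x - t • ν - p‖ ≤ ‖x - p‖ + ‖t • ν‖ := by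
      have := norm_sub_le (x - p) (t • ν)
      rwa [show x - p - t • ν = x - t • ν - p by abel] at this
    rw [norm_smul, Real.norm_eq_abs, abs_of_pos ht] at this
    linarith
  have hρx : ρ x ≤ 0 := by
    by_cases hxo : x ∈ Ω
    · have : x ∈ Ω ∩ U := ⟨hxo, hb hxr⟩
      rw [h1] at this; exact this.2.le
    · have : x ∈ frontier Ω ∩ U := ⟨by rw [ho.frontier_eq]; exact ⟨hxc, hxo⟩, hb hxr⟩
      rw [h2] at this; exact this.2.le
  have := hmono (x - t • ν) hyr t ht (by simpa using hxr)
  have h3 : x - t • ν ∈ {y ∈ U | ρ y < 0} := ⟨hb hyr, by simp at this; linarith⟩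
  rw [← h1] at h3
  exact h3.1

lemma rg_frontier_null {n : ℕ} {Ω : Set (EuclideanSpace ℝ (Fin n))}
    (hs : HasSmoothBoundary Ω) : volume (frontier Ω) = 0 := by
  apply measure_null_of_locally_null
  intro p hp
  obtain ⟨U, ρ, hU, hpU, hρ, hd, h1, h2⟩ := hs p hp
  refine ⟨frontier Ω ∩ U, ?_, ?_⟩
  · exact inter_mem_nhdsWithin _ (hU.mem_nhds hpU)
  · refine measure_mono_null ?_ (rg_null_level volume hU (hρ.of_le (by exact_mod_cast le_top)))
    intro x hx
    have hx' := hx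
    rw [h2] at hx'
    exact ⟨hx.2, hx'.2, hd x hx.2⟩

end bdry
section approx
open Filter Topology Set

lemma rg_approx {n : ℕ} {Ω : Set (EuclideanSpace ℝ (Fin n))} (ho : IsOpen Ω)
    (hbd : Bornology.IsBounded Ω) (hs : HasSmoothBoundary Ω)
    {f : EuclideanSpace ℝ (Fin n) → ℝ} (hf : ContDiffOn ℝ (⊤ : ℕ∞) f Ω) {M : ℝ}
    (hM : ∀ x ∈ Ω, |f x| ≤ M) (hM' : ∀ x ∈ Ω, ‖fderiv ℝ f x‖ ≤ M) :
    ∃ (F : ℕ → EuclideanSpace ℝ (Fin n) → ℝ) (C : ℝ),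
      (∀ k, ContDiff ℝ (⊤ : ℕ∞) (F k)) ∧ (∀ k, HasCompactSupport (F k)) ∧
      (∀ k, ∀ x ∈ Ω, |F k x| ≤ C) ∧ (∀ k, ∀ x ∈ Ω, ‖fderiv ℝ (F k) x‖ ≤ C) ∧
      (∀ x ∈ Ω, Tendsto (fun k => F k x) atTop (𝓝 (f x))) ∧
      (∀ x ∈ Ω, Tendsto (fun k => fderiv ℝ (F k) x) atTop (𝓝 (fderiv ℝ f x))) := by
  have hK : IsCompact (closure Ω) := hbd.isCompact_closure
  choose! V ν δ hVo hpV hδ hin using rg_inward ho hs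
  obtain ⟨t, ht, hcov⟩ := hK.elim_nhds_subcover V (fun p hp => (hVo p hp).mem_nhds (hpV p hp))
  obtain ⟨χ, hχ⟩ := SmoothPartitionOfUnity.exists_isSubordinate
    (modelWithCornersSelf ℝ (EuclideanSpace ℝ (Fin n))) (s := closure Ω) isClosed_closure
    (fun j : t => V j) (fun j => hVo j (ht j j.2)) (by
      intro x hx
      have := hcov hx
      simp only [mem_iUnion] at this ⊢
      obtain ⟨i, hi, hx⟩ := this
      exact ⟨⟨i, hi⟩, hx⟩)
  have hχs : ∀ j, ContDiff ℝ (⊤ : ℕ∞) (χ j) := fun j => (χ j).contMDiff.contDiff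
  have hχ1 : ∀ x ∈ closure Ω, ∑ j, χ j x = 1 := by
    intro x hx
    have := χ.sum_eq_one hx
    rwa [finsum_eq_sum_of_fintype] at this
  obtain ⟨δ0, hδ00, hδ0⟩ : ∃ δ0 : ℝ, 0 < δ0 ∧ ∀ p ∈ t, δ0 ≤ δ p := by
    have h1 : ∀ᶠ s in 𝓝[>] (0 : ℝ), ∀ p ∈ t, s ≤ δ p := (Filter.eventually_all_finset t).2
      fun p hp => mem_nhdsWithin_of_mem_nhds (Iic_mem_nhds (hδ p (ht p hp)))
    obtain ⟨s, hs1, hs2⟩ := (h1.and self_mem_nhdsWithin).exists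
    exact ⟨s, hs2, hs1⟩
  set τ : ℕ → ℝ := fun k => δ0 / (k + 1) with hτ
  have hτpos : ∀ k, 0 < τ k := fun k => by simp only [hτ]; positivity
  have hτle : ∀ k, τ k ≤ δ0 := fun k =>
    div_le_self hδ00.le (by linarith [(Nat.cast_nonneg k : (0:ℝ) ≤ k)])
  have hτ0 : Tendsto τ atTop (𝓝 0) := by
    have := tendsto_one_div_add_atTop_nhds_zero_nat (𝕜 := ℝ) |>.const_mul δ0
    simpa [hτ, div_eq_mul_inv] using this
  have hshift : ∀ k (j : t), ∀ x ∈ closure Ω, x ∈ tsupport (χ j) → x - τ k • ν j ∈ Ω :=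
    fun k j x hx hxs => hin j (ht j j.2) x (hχ j hxs) hx _ (hτpos k)
      ((hτle k).trans (hδ0 j j.2))
  set O : ℕ → Set (EuclideanSpace ℝ (Fin n)) := fun k =>
    ⋂ j : t, ((tsupport (χ j))ᶜ ∪ (fun x => x - τ k • ν j) ⁻¹' Ω) with hO
  have hOo : ∀ k, IsOpen (O k) := fun k => isOpen_iInter_of_finite fun j =>
    (isClosed_tsupport _).isOpen_compl.union (ho.preimage (by fun_prop))
  have hKO : ∀ k, closure Ω ⊆ O k := by
    intro k x hx
    simp only [hO, mem_iInter]
    intro j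
    by_cases h : x ∈ tsupport (χ j)
    · exact Or.inr (hshift k j x hx h)
    · exact Or.inl h
  choose η hηs hηc hηt hη1 using fun k => rg_cutoff hK (hOo k) (hKO k)
  set T : ℕ → t → EuclideanSpace ℝ (Fin n) → ℝ := fun k j x => χ j x * f (x - τ k • ν j) with hT
  have hTz : ∀ k j x, x ∉ tsupport (χ j) → T k j =ᶠ[𝓝 x] fun _ => 0 := by
    intro k j x hx
    filter_upwards [notMem_tsupport_iff_eventuallyEq.1 hx] with y hy
    simp only [hT, hy]; simp
  have hTs : ∀ k j, ∀ x ∈ O k, ContDiffAt ℝ (⊤ : ℕ∞) (T k j) x := by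
    intro k j x hx
    by_cases h : x ∈ tsupport (χ j)
    · have hx' : x - τ k • ν j ∈ Ω := by
        simp only [hO, mem_iInter] at hx
        exact (hx j).resolve_left (fun h' => h' h)
      refine (hχs j).contDiffAt.mul ?_
      exact (hf.contDiffAt (ho.mem_nhds hx')).comp x (f := fun x => x - τ k • ν j) (by fun_prop)
    · exact contDiffAt_const.congr_of_eventuallyEq (hTz k j x h)
  have hTd : ∀ k j, ∀ x ∈ Ω, HasFDerivAt (T k j)
      (χ j x • fderiv ℝ f (x - τ k • ν j) + f (x - τ k • ν j) • fderiv ℝ (χ j) x) x := by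
    intro k j x hx
    by_cases h : x ∈ tsupport (χ j)
    · have hx' := hshift k j x (subset_closure hx) h
      have h1 : HasFDerivAt f (fderiv ℝ f (x - τ k • ν j)) (x - τ k • ν j) :=
        ((hf.contDiffAt (ho.mem_nhds hx')).differentiableAt (by simp)).hasFDerivAt
      have h2 : HasFDerivAt (fun x => f (x - τ k • ν j)) (fderiv ℝ f (x - τ k • ν j)) x := by
        have := h1.comp x ((hasFDerivAt_id x).sub_const (τ k • ν j))
        simpa [Function.comp_def] using this
      have h3 : HasFDerivAt (χ j) (fderiv ℝ (χ j) x) x :=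
        ((hχs j).differentiable (by simp) x).hasFDerivAt
      exact h3.mul h2
    · have h0 : χ j x = 0 := image_eq_zero_of_notMem_tsupport h
      have h1 : fderiv ℝ (χ j) x = 0 := by
        rw [(notMem_tsupport_iff_eventuallyEq.1 h).fderiv_eq]; simp
      rw [h0, h1]
      have := (hasFDerivAt_const (𝕜 := ℝ) (0 : ℝ) x).congr_of_eventuallyEq (hTz k j x h)
      simpa using this
  have hFS : ∀ k, ∀ x ∈ Ω, (fun x => η k x * ∑ j, T k j x) =ᶠ[𝓝 x] fun x => ∑ j, T k j x := by
    intro k x hx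
    filter_upwards [ho.mem_nhds hx] with y hy
    rw [hη1 k y (subset_closure hy), one_mul]
  have hFd : ∀ k, ∀ x ∈ Ω, fderiv ℝ (fun x => η k x * ∑ j, T k j x) x =
      ∑ j, (χ j x • fderiv ℝ f (x - τ k • ν j) + f (x - τ k • ν j) • fderiv ℝ (χ j) x) := by
    intro k x hx
    rw [(hFS k x hx).fderiv_eq]
    exact (HasFDerivAt.fun_sum fun j _ => hTd k j x hx).fderiv
  have hD : ∀ j, ∃ D : ℝ, ∀ x ∈ closure Ω, ‖fderiv ℝ (χ j) x‖ ≤ D := fun j =>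
    hK.exists_bound_of_continuousOn ((hχs j).continuous_fderiv (by simp)).continuousOn
  choose D hD using hD
  have hχa : ∀ j x, |χ j x| ≤ 1 := fun j x => by
    rw [abs_of_nonneg (χ.nonneg j x)]; exact χ.le_one j x
  have hlim : ∀ x ∈ Ω, ∀ j : t, Tendsto (fun k => x - τ k • ν j) atTop (𝓝 x) := by
    intro x hx j
    have : Tendsto (fun k => x - τ k • ν j) atTop (𝓝 (x - (0:ℝ) • (ν j))) :=
      tendsto_const_nhds.sub (hτ0.smul_const _)
    simpa using this
  refine ⟨fun k x => η k x * ∑ j, T k j x, ∑ j, (M + M * D j), ?_, ?_, ?_, ?_, ?_, ?_⟩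
  · intro k
    rw [contDiff_iff_contDiffAt]
    intro x
    by_cases hx : x ∉ tsupport (fun x => η k x * ∑ j, T k j x)
    · exact contDiffAt_const.congr_of_eventuallyEq (notMem_tsupport_iff_eventuallyEq.1 hx)
    rw [not_not] at hx
    have hx' : x ∈ tsupport (η k) := tsupport_mul_subset_left hx
    exact (hηs k).contDiffAt.mul (ContDiffAt.sum fun j _ => hTs k j x (hηt k hx'))
  · intro k
    exact (hηc k).mul_right
  · intro k x hx
    have hM0 : 0 ≤ M := (abs_nonneg _).trans (hM x hx)
    beta_reduce
    rw [show η k x * ∑ j, T k j x = _ from (hFS k x hx).eq_of_nhds]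
    refine (Finset.abs_sum_le_sum_abs _ _).trans (Finset.sum_le_sum fun j _ => ?_)
    have hD0 : 0 ≤ D j := (norm_nonneg _).trans (hD j x (subset_closure hx))
    have : |T k j x| ≤ M := by
      by_cases h : x ∈ tsupport (χ j)
      · simp only [hT, abs_mul]
        have h1 := hM _ (hshift k j x (subset_closure hx) h)
        calc _ ≤ 1 * M := mul_le_mul (hχa j x) h1 (abs_nonneg _) zero_le_one
          _ = M := one_mul _
      · rw [(hTz k j x h).eq_of_nhds]; simpa using hM0
    have := mul_nonneg hM0 hD0
    linarith
  · intro k x hx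
    have hM0 : 0 ≤ M := (abs_nonneg _).trans (hM x hx)
    rw [hFd k x hx]
    refine (norm_sum_le _ _).trans (Finset.sum_le_sum fun j _ => ?_)
    have hD0 : 0 ≤ D j := (norm_nonneg _).trans (hD j x (subset_closure hx))
    by_cases h : x ∈ tsupport (χ j)
    · have hx' := hshift k j x (subset_closure hx) h
      refine (norm_add_le _ _).trans (add_le_add ?_ ?_)
      · rw [norm_smul, Real.norm_eq_abs]
        calc _ ≤ 1 * M := mul_le_mul (hχa j x) (hM' _ hx') (norm_nonneg _) zero_le_one
          _ = M := one_mul _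
      · rw [norm_smul, Real.norm_eq_abs]
        exact mul_le_mul (hM _ hx') (hD j x (subset_closure hx)) (norm_nonneg _) hM0
    · have h0 : χ j x = 0 := image_eq_zero_of_notMem_tsupport h
      have h1 : fderiv ℝ (χ j) x = 0 := by
        rw [(notMem_tsupport_iff_eventuallyEq.1 h).fderiv_eq]; simp
      rw [h0, h1]
      have := mul_nonneg hM0 hD0
      simp; linarith
  · intro x hx
    have h1 : Tendsto (fun k => ∑ j, T k j x) atTop (𝓝 (∑ j, χ j x * f x)) := by
      refine tendsto_finsetSum _ fun j _ => tendsto_const_nhds.mul ?_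
      exact (hf.contDiffAt (ho.mem_nhds hx)).continuousAt.tendsto.comp (hlim x hx j)
    rw [← Finset.sum_mul, hχ1 x (subset_closure hx), one_mul] at h1
    exact h1.congr fun k => ((hFS k x hx).eq_of_nhds).symm
  · intro x hx
    have hc : ContinuousAt (fderiv ℝ f) x :=
      (hf.continuousOn_fderiv_of_isOpen ho (by simp)).continuousAt (ho.mem_nhds hx)
    have h1 : Tendsto (fun k => ∑ j, (χ j x • fderiv ℝ f (x - τ k • ν j) +
        f (x - τ k • ν j) • fderiv ℝ (χ j) x)) atTop
        (𝓝 (∑ j, (χ j x • fderiv ℝ f x + f x • fderiv ℝ (χ j) x))) := by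
      refine tendsto_finsetSum _ fun j _ => Tendsto.add (tendsto_const_nhds.smul ?_)
        (Tendsto.smul_const ?_ _)
      · exact hc.tendsto.comp (hlim x hx j)
      · exact (hf.contDiffAt (ho.mem_nhds hx)).continuousAt.tendsto.comp (hlim x hx j)
    have h2 : ∑ j, fderiv ℝ (χ j) x = 0 := by
      have h3 : HasFDerivAt (fun x => ∑ j, χ j x) (∑ j, fderiv ℝ (χ j) x) x :=
        HasFDerivAt.fun_sum fun j _ => ((hχs j).differentiable (by simp) x).hasFDerivAt
      have h4 : (fun x => ∑ j, χ j x) =ᶠ[𝓝 x] fun _ => (1 : ℝ) := by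
        filter_upwards [ho.mem_nhds hx] with y hy using hχ1 y (subset_closure hy)
      rw [← h3.fderiv, h4.fderiv_eq]; simp
    rw [Finset.sum_add_distrib, ← Finset.sum_smul, ← Finset.smul_sum, h2,
      hχ1 x (subset_closure hx), one_smul, smul_zero, add_zero] at h1
    exact h1.congr fun k => (hFd k x hx).symm

lemma rg_bdd {n : ℕ} {Ω : Set (EuclideanSpace ℝ (Fin n))} (ho : IsOpen Ω)
    (hbd : Bornology.IsBounded Ω) {u : EuclideanSpace ℝ (Fin n) → ℝ}
    (hu : ContDiffOn ℝ (⊤ : ℕ∞) u (closure Ω)) :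
    ∃ M : ℝ, ∀ x ∈ Ω, |u x| ≤ M ∧ ‖fderiv ℝ u x‖ ≤ M ∧ ‖fderiv ℝ (fderiv ℝ u) x‖ ≤ M := by
  have hK : IsCompact (closure Ω) := hbd.isCompact_closure
  have main : ∃ M : ℝ, ∀ x ∈ closure Ω, x ∈ Ω → ∀ m ≤ 2, ‖iteratedFDeriv ℝ m u x‖ ≤ M := by
    refine hK.induction_on (p := fun s => ∃ M : ℝ, ∀ x ∈ s, x ∈ Ω → ∀ m ≤ 2,
      ‖iteratedFDeriv ℝ m u x‖ ≤ M) ⟨0, by simp⟩ ?_ ?_ ?_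
    · rintro s t hst ⟨M, hM⟩
      exact ⟨M, fun x hx => hM x (hst hx)⟩
    · rintro s t ⟨M, hM⟩ ⟨N, hN⟩
      refine ⟨max M N, fun x hx hxo m hm => ?_⟩
      rcases hx with hx | hx
      · exact (hM x hx hxo m hm).trans (le_max_left _ _)
      · exact (hN x hx hxo m hm).trans (le_max_right _ _)
    · intro p hp
      have h2 : ContDiffWithinAt ℝ 2 u (closure Ω) p :=
        (hu p hp).of_le (WithTop.coe_le_coe.2 (le_top : (2 : ℕ∞) ≤ ⊤))
      obtain ⟨s, hs, q, hq⟩ := h2 2 le_rfl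
      rw [insert_eq_of_mem hp] at hs
      have hps : p ∈ s := mem_of_mem_nhdsWithin hp hs
      have hev : ∀ᶠ x in 𝓝[s] p, ∀ m ∈ Finset.range 3, ‖q x m‖ < ‖q p m‖ + 1 := by
        rw [Filter.eventually_all_finset]
        intro m hm
        have hm' : m ≤ 2 := by simp at hm; omega
        have hc := (hq.cont m (by exact_mod_cast hm') p hps).norm
        exact hc.tendsto.eventually (gt_mem_nhds (by linarith))
      have hev' : ∀ᶠ x in 𝓝[closure Ω] p, x ∈ s ∧ ∀ m ∈ Finset.range 3, ‖q x m‖ < ‖q p m‖ + 1 := by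
        rw [eventually_nhdsWithin_iff] at hev
        have := hev.filter_mono (nhdsWithin_le_nhds (s := closure Ω))
        filter_upwards [hs, this] with x hx hx' using ⟨hx, hx' hx⟩
      obtain ⟨O, hOo, hpO, hO⟩ := mem_nhdsWithin.1 hev'
      refine ⟨O ∩ closure Ω, inter_comm (closure Ω) O ▸ inter_mem_nhdsWithin _ (hOo.mem_nhds hpO),
        ∑ m ∈ Finset.range 3, (‖q p m‖ + 1), ?_⟩
      intro x hx hxo m hm
      have hop : IsOpen (O ∩ Ω) := hOo.inter ho
      have hsub : O ∩ Ω ⊆ s := fun y hy => (hO ⟨hy.1, subset_closure hy.2⟩).1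
      have he := (hq.mono hsub).eq_iteratedFDerivWithin_of_uniqueDiffOn (m := m)
        (by exact_mod_cast hm) hop.uniqueDiffOn ⟨hx.1, hxo⟩
      rw [iteratedFDerivWithin_of_isOpen m hop ⟨hx.1, hxo⟩] at he
      rw [← he]
      have hm3 : m ∈ Finset.range 3 := by simp; omega
      refine ((hO hx).2 m hm3).le.trans ?_
      exact Finset.single_le_sum (f := fun m => ‖q p m‖ + 1) (fun i _ => by positivity) hm3
  obtain ⟨M, hM⟩ := main
  refine ⟨M, fun x hx => ?_⟩
  have h := hM x (subset_closure hx) hx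
  refine ⟨?_, ?_, ?_⟩
  · simpa using h 0 (by norm_num)
  · have := h 1 (by norm_num)
    rwa [← norm_iteratedFDeriv_fderiv, norm_iteratedFDeriv_zero] at this
  · have := h 2 (by norm_num)
    rwa [← norm_iteratedFDeriv_fderiv, ← norm_iteratedFDeriv_fderiv, norm_iteratedFDeriv_zero] at this

end approx
section core
open Filter Topology Set

lemma rg_im {α : Type*} [MeasurableSpace α] {μ : Measure α} {f g : α → ℝ}
    (hf : MemLp f 2 μ) (hg : MemLp g 2 μ) : Integrable (fun x => f x * g x) μ :=
  hf.integrable_mul hg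

lemma rg_l2_lim {α : Type*} [MeasurableSpace α] {μ : Measure α} {a : ℕ → α → ℝ} {h : α → ℝ}
    (ha : ∀ k, MemLp (a k) 2 μ) (hh : MemLp h 2 μ)
    (hl : Tendsto (fun k => ∫ x, (a k x) ^ 2 ∂μ) atTop (𝓝 0)) :
    Tendsto (fun k => ∫ x, a k x * h x ∂μ) atTop (𝓝 0) := by
  have hcs : ∀ k, ‖∫ x, a k x * h x ∂μ‖ ≤
      (∫ x, (a k x) ^ 2 ∂μ) ^ (1 / 2 : ℝ) * (∫ x, (h x) ^ 2 ∂μ) ^ (1 / 2 : ℝ) := by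
    intro k
    refine (norm_integral_le_integral_norm _).trans ?_
    have := integral_mul_le_Lp_mul_Lq_of_nonneg (μ := μ) Real.HolderConjugate.two_two
      (f := fun x => |a k x|) (g := fun x => |h x|)
      (Eventually.of_forall fun x => abs_nonneg _) (Eventually.of_forall fun x => abs_nonneg _)
      (by rw [ENNReal.ofReal_ofNat]; exact (ha k).abs) (by rw [ENNReal.ofReal_ofNat]; exact hh.abs)
    simpa [norm_mul] using this
  refine squeeze_zero_norm hcs ?_
  have h1 : Tendsto (fun k => (∫ x, (a k x) ^ 2 ∂μ) ^ (1 / 2 : ℝ)) atTop (𝓝 ((0 : ℝ) ^ (1 / 2 : ℝ))) :=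
    hl.rpow_const (Or.inr (by norm_num))
  have h2 := h1.mul_const ((∫ x, (h x) ^ 2 ∂μ) ^ (1 / 2 : ℝ))
  simpa [Real.zero_rpow] using h2

lemma rg_dct {α : Type*} [MeasurableSpace α] {μ : Measure α} {Ω : Set α} (hΩ : MeasurableSet Ω)
    {h : α → ℝ} (hh : Integrable h (μ.restrict Ω)) {F : ℕ → α → ℝ} {f : α → ℝ} {C : ℝ}
    (hF : ∀ k, AEStronglyMeasurable (F k) (μ.restrict Ω)) (hb : ∀ k, ∀ x ∈ Ω, |F k x| ≤ C)
    (hl : ∀ᵐ x ∂(μ.restrict Ω), Tendsto (fun k => F k x) atTop (𝓝 (f x))) :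
    Tendsto (fun k => ∫ x in Ω, h x * F k x ∂μ) atTop (𝓝 (∫ x in Ω, h x * f x ∂μ)) := by
  refine tendsto_integral_of_dominated_convergence (fun x => |h x| * C)
    (fun k => hh.aestronglyMeasurable.mul (hF k)) (hh.abs.mul_const C) ?_ ?_
  · intro k
    filter_upwards [ae_restrict_mem hΩ] with x hx
    rw [norm_mul, Real.norm_eq_abs, Real.norm_eq_abs]
    exact mul_le_mul_of_nonneg_left (hb k x hx) (abs_nonneg _)
  · filter_upwards [hl] with x hx
    exact hx.const_mul _

lemma rg_theta : ∃ (θ : ℝ → ℝ) (C : ℝ), ContDiff ℝ (⊤ : ℕ∞) θ ∧ (∀ t, |t| ≤ 1 → θ t = 0) ∧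
    (∀ t, 2 ≤ |t| → θ t = t) ∧ (∀ t, |θ t| ≤ |t|) ∧ (∀ t, |deriv θ t| ≤ C) ∧
    (∀ t, 2 < |t| → deriv θ t = 1) := by
  let b : ContDiffBump (0 : ℝ) := ⟨1, 2, by norm_num, by norm_num⟩
  have hs : ContDiff ℝ (⊤ : ℕ∞) (fun t : ℝ => t * (1 - b t)) :=
    contDiff_id.mul (contDiff_const.sub b.contDiff)
  have h2 : ∀ t : ℝ, 2 ≤ |t| → t * (1 - b t) = t := by
    intro t ht
    rw [b.zero_of_le_dist (by simpa using ht)]; simp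
  have hd : ∀ t, 2 < |t| → deriv (fun t : ℝ => t * (1 - b t)) t = 1 := by
    intro t ht
    have : (fun t : ℝ => t * (1 - b t)) =ᶠ[𝓝 t] id := by
      have : ∀ᶠ s in 𝓝 t, 2 < |s| := continuous_abs.continuousAt.eventually (lt_mem_nhds ht)
      filter_upwards [this] with s hs using h2 s hs.le
    rw [this.deriv_eq]; simp
  obtain ⟨C, hC⟩ := (isCompact_closedBall (0:ℝ) 3).exists_bound_of_continuousOn
    (hs.continuous_deriv (by simp)).continuousOn
  refine ⟨fun t => t * (1 - b t), max C 1, hs, ?_, h2, ?_, ?_, hd⟩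
  · intro t ht
    have := b.one_of_mem_closedBall (x := t) (by simpa [b] using ht)
    simp [this]
  · intro t
    rw [abs_mul]
    have h0 := b.nonneg (x := t)
    have h1 := b.le_one (x := t)
    have : |1 - b t| ≤ 1 := by rw [abs_le]; constructor <;> linarith
    nlinarith [abs_nonneg t]
  · intro t
    by_cases ht : |t| ≤ 3
    · exact (hC t (by simpa using ht)).trans (le_max_left _ _)
    · rw [hd t (by linarith)]; simp

lemma rg_test_pd {n : ℕ} {φ : EuclideanSpace ℝ (Fin n) → ℝ} (h : ContDiff ℝ (⊤ : ℕ∞) φ)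
    (e : EuclideanSpace ℝ (Fin n)) : ContDiff ℝ (⊤ : ℕ∞) (fun x => fderiv ℝ φ x e) :=
  (h.fderiv_right (m := (⊤ : ℕ∞)) (by simp)).clm_apply contDiff_const

lemma rg_lap {n : ℕ} {φ : EuclideanSpace ℝ (Fin n) → ℝ} {x : EuclideanSpace ℝ (Fin n)}
    (h : DifferentiableAt ℝ (fderiv ℝ φ) x) :
    lap φ x = ∑ i, fderiv ℝ (fun y => fderiv ℝ φ y (EuclideanSpace.single i 1)) x
      (EuclideanSpace.single i 1) := by
  unfold lap
  refine Finset.sum_congr rfl fun i _ => ?_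
  rw [iteratedFDeriv_two_apply, fderiv_clm_apply h (differentiableAt_const _)]
  simp

lemma rg_pd_cs {n : ℕ} {φ : EuclideanSpace ℝ (Fin n) → ℝ} (h : HasCompactSupport φ)
    (e : EuclideanSpace ℝ (Fin n)) : HasCompactSupport (fun x => fderiv ℝ φ x e) :=
  h.fderiv_apply (𝕜 := ℝ) e

lemma rg_pd_ts {n : ℕ} (φ : EuclideanSpace ℝ (Fin n) → ℝ)
    (e : EuclideanSpace ℝ (Fin n)) : tsupport (fun x => fderiv ℝ φ x e) ⊆ tsupport φ :=
  tsupport_fderiv_apply_subset ℝ e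

lemma rg_W1 {n : ℕ} {Ω : Set (EuclideanSpace ℝ (Fin n))}
    {w : EuclideanSpace ℝ (Fin n) → ℝ} {g : Fin n → EuclideanSpace ℝ (Fin n) → ℝ}
    {φ : ℕ → EuclideanSpace ℝ (Fin n) → ℝ}
    (hw : MemLp w 2 (volume.restrict Ω)) (hg : ∀ i, MemLp (g i) 2 (volume.restrict Ω))
    (hφ : ∀ k, IsTest Ω (φ k))
    (hl : Tendsto (fun k => ∫ x in Ω, ((w x - φ k x) ^ 2 +
        ∑ i, (g i x - fderiv ℝ (φ k) x (EuclideanSpace.single i 1)) ^ 2)) atTop (𝓝 0))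
    (i : Fin n) {ψ : EuclideanSpace ℝ (Fin n) → ℝ} (hψ : ContDiff ℝ (⊤ : ℕ∞) ψ)
    (hψc : HasCompactSupport ψ) :
    ∫ x in Ω, w x * fderiv ℝ ψ x (EuclideanSpace.single i 1) = - ∫ x in Ω, g i x * ψ x := by
  set e : Fin n → EuclideanSpace ℝ (Fin n) := fun i => EuclideanSpace.single i 1 with he
  have hmem : ∀ ψ : EuclideanSpace ℝ (Fin n) → ℝ, ContDiff ℝ (⊤ : ℕ∞) ψ → HasCompactSupport ψ →
      MemLp ψ 2 (volume.restrict Ω) := fun ψ h1 h2 =>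
    (h1.continuous.memLp_of_hasCompactSupport h2).restrict Ω
  have hφm : ∀ k, MemLp (φ k) 2 (volume.restrict Ω) := fun k => hmem _ (hφ k).1 (hφ k).2.1
  have hφd : ∀ k j, MemLp (fun x => fderiv ℝ (φ k) x (e j)) 2 (volume.restrict Ω) := fun k j =>
    hmem _ (rg_test_pd (hφ k).1 _) (rg_pd_cs (hφ k).2.1 _)
  have hψm := hmem ψ hψ hψc
  have hψd := hmem _ (rg_test_pd hψ (e i)) (rg_pd_cs hψc (e i))
  have ha : ∀ k, MemLp (fun x => w x - φ k x) 2 (volume.restrict Ω) := fun k => hw.sub (hφm k)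
  have hb : ∀ k j, MemLp (fun x => g j x - fderiv ℝ (φ k) x (e j)) 2 (volume.restrict Ω) :=
    fun k j => (hg j).sub (hφd k j)
  have hint : ∀ k, Integrable (fun x => ((w x - φ k x) ^ 2 +
        ∑ i, (g i x - fderiv ℝ (φ k) x (e i)) ^ 2)) (volume.restrict Ω) := fun k =>
    (ha k).integrable_sq.add (integrable_finsetSum _ fun j _ => (hb k j).integrable_sq)
  have hla : Tendsto (fun k => ∫ x in Ω, (w x - φ k x) ^ 2) atTop (𝓝 0) := by
    refine squeeze_zero (fun k => integral_nonneg fun x => sq_nonneg _) (fun k => ?_) hl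
    refine integral_mono (ha k).integrable_sq (hint k) fun x => ?_
    exact le_add_of_nonneg_right (Finset.sum_nonneg fun j _ => sq_nonneg _)
  have hlb : Tendsto (fun k => ∫ x in Ω, (g i x - fderiv ℝ (φ k) x (e i)) ^ 2) atTop (𝓝 0) := by
    refine squeeze_zero (fun k => integral_nonneg fun x => sq_nonneg _) (fun k => ?_) hl
    refine integral_mono (hb k i).integrable_sq (hint k) fun x => ?_
    exact le_add_of_nonneg_of_le (sq_nonneg _) (Finset.single_le_sum
      (f := fun i => (g i x - fderiv ℝ (φ k) x (e i)) ^ 2) (fun j _ => sq_nonneg _)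
      (Finset.mem_univ i))
  have h1 := (rg_l2_lim ha hψd hla).add (rg_l2_lim (fun k => hb k i) hψm hlb)
  have hibp : ∀ k, ∫ x in Ω, φ k x * fderiv ℝ ψ x (e i) = - ∫ x in Ω, fderiv ℝ (φ k) x (e i) * ψ x := by
    intro k
    have hd : Differentiable ℝ ψ := hψ.differentiable (by simp)
    have hd' : Differentiable ℝ (φ k) := (hφ k).1.differentiable (by simp)
    rw [setIntegral_eq_integral_of_forall_compl_eq_zero, setIntegral_eq_integral_of_forall_compl_eq_zero]
    · apply integral_mul_fderiv_eq_neg_fderiv_mul_of_integrable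
      · exact ((rg_test_pd (hφ k).1 _).continuous.mul hψ.continuous).integrable_of_hasCompactSupport
          ((rg_pd_cs (hφ k).2.1 _).mul_right)
      · exact ((hφ k).1.continuous.mul (rg_test_pd hψ _).continuous).integrable_of_hasCompactSupport
          ((hφ k).2.1.mul_right)
      · exact ((hφ k).1.continuous.mul hψ.continuous).integrable_of_hasCompactSupport
          ((hφ k).2.1.mul_right)
      · exact fun x _ => hd' x
      · exact fun x _ => hd x
    · intro x hx
      have : x ∉ tsupport (fun x => fderiv ℝ (φ k) x (e i)) := fun h =>
        hx ((hφ k).2.2 (rg_pd_ts _ _ h))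
      have h0 : fderiv ℝ (φ k) x (e i) = 0 :=
        image_eq_zero_of_notMem_tsupport (f := fun x => fderiv ℝ (φ k) x (e i)) this
      rw [h0, zero_mul]
    · intro x hx
      rw [image_eq_zero_of_notMem_tsupport (fun h => hx ((hφ k).2.2 h)), zero_mul]
  have h3 : ∀ k, (∫ x in Ω, (w x - φ k x) * fderiv ℝ ψ x (e i)) +
      ∫ x in Ω, (g i x - fderiv ℝ (φ k) x (e i)) * ψ x =
      (∫ x in Ω, w x * fderiv ℝ ψ x (e i)) + ∫ x in Ω, g i x * ψ x := by
    intro k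
    simp only [sub_mul]
    rw [integral_sub (rg_im hw hψd) (rg_im (hφm k) hψd),
      integral_sub (rg_im (hg i) hψm) (rg_im (hφd k i) hψm), hibp k]
    ring
  simp only [h3] at h1
  have := tendsto_nhds_unique h1 tendsto_const_nhds
  simp only [he] at this ⊢
  linarith

end core
section core2
open Filter Topology Set

lemma rg_core {n : ℕ} {Ω₁ Ω₂ : Set (EuclideanSpace ℝ (Fin n))} (h12 : Ω₁ ⊆ Ω₂)
    (h1open : IsOpen Ω₁) (h2open : IsOpen Ω₂)
    (h1bdd : Bornology.IsBounded Ω₁) (h2bdd : Bornology.IsBounded Ω₂)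
    (h1smooth : HasSmoothBoundary Ω₁)
    {w v : EuclideanSpace ℝ (Fin n) → ℝ} {g : Fin n → EuclideanSpace ℝ (Fin n) → ℝ}
    (hw : MemLp w 2 (volume.restrict Ω₂)) (hg : ∀ i, MemLp (g i) 2 (volume.restrict Ω₂))
    (hv : MemLp v 2 (volume.restrict Ω₂)) (hv0 : ∀ x, x ∉ Ω₁ → v x = 0)
    (hW1 : ∀ i, ∀ ψ : EuclideanSpace ℝ (Fin n) → ℝ, ContDiff ℝ (⊤ : ℕ∞) ψ →
      HasCompactSupport ψ →
      ∫ x in Ω₂, w x * fderiv ℝ ψ x (EuclideanSpace.single i 1) = - ∫ x in Ω₂, g i x * ψ x)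
    (hlap : ∀ φ, IsTest Ω₂ φ → ∫ y in Ω₂, w y * lap φ y = - ∫ y in Ω₂, v y * φ y)
    (hw0 : ∀ᵐ x ∂volume, x ∈ Ω₂ \ closure Ω₁ → w x = 0)
    {u : EuclideanSpace ℝ (Fin n) → ℝ}
    (hu : ContDiffOn ℝ (⊤ : ℕ∞) u (closure Ω₁)) (huharm : IsHarmonicOn u Ω₁)
    (hu0 : ∀ x ∈ frontier Ω₁ ∩ frontier Ω₂, u x = 0) :
    ∫ x in Ω₁, v x * u x = 0 := by
  set e : Fin n → EuclideanSpace ℝ (Fin n) := fun i => EuclideanSpace.single i 1 with he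
  have hen : ∀ i, ‖e i‖ = 1 := fun i => by simp [he]
  have hfin2 : volume Ω₂ < ⊤ := h2bdd.measure_lt_top
  have hfin1 : volume Ω₁ < ⊤ := h1bdd.measure_lt_top
  have : IsFiniteMeasure (volume.restrict Ω₂) := ⟨by simpa using hfin2⟩
  have : IsFiniteMeasure (volume.restrict Ω₁) := ⟨by simpa using hfin1⟩
  have hm1 := h1open.measurableSet
  have hres : volume.restrict Ω₁ ≤ volume.restrict Ω₂ := Measure.restrict_mono h12 le_rfl
  have i2 : ∀ {f : EuclideanSpace ℝ (Fin n) → ℝ}, MemLp f 2 (volume.restrict Ω₂) →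
      Integrable f (volume.restrict Ω₂) := fun h => h.integrable (by norm_num)
  have i1 : ∀ {f : EuclideanSpace ℝ (Fin n) → ℝ}, MemLp f 2 (volume.restrict Ω₂) →
      Integrable f (volume.restrict Ω₁) := fun h => (i2 h).mono_measure hres
  -- the transfer of integrals
  have htr : ∀ h : EuclideanSpace ℝ (Fin n) → ℝ, (∀ᵐ x ∂volume, x ∈ Ω₂ \ closure Ω₁ → h x = 0) →
      ∫ x in Ω₂, h x = ∫ x in Ω₁, h x := by
    intro h hh
    refine setIntegral_eq_of_subset_of_ae_sdiff_eq_zero h2open.measurableSet.nullMeasurableSet h12 ?_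
    have hfr : ∀ᵐ x ∂volume, x ∉ frontier Ω₁ := measure_eq_zero_iff_ae_notMem.1 (rg_frontier_null h1smooth)
    filter_upwards [hh, hfr] with x hx hxf hxd
    refine hx ⟨hxd.1, fun hc => hxf ?_⟩
    rw [h1open.frontier_eq]; exact ⟨hc, hxd.2⟩
  have hOo : IsOpen (Ω₂ \ closure Ω₁) := h2open.sdiff isClosed_closure
  have hg0 : ∀ i, ∀ᵐ x ∂volume, x ∈ Ω₂ \ closure Ω₁ → g i x = 0 := by
    intro i
    refine hOo.ae_eq_zero_of_integral_contDiff_smul_eq_zero ?_ ?_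
    · have : IntegrableOn (g i) Ω₂ volume := i2 (hg i)
      exact (this.mono_set sdiff_subset).locallyIntegrableOn
    · intro φ hφ hφc hφt
      have h1 : ∫ x, φ x • g i x = ∫ x in Ω₂, g i x * φ x := by
        rw [setIntegral_eq_integral_of_forall_compl_eq_zero]
        · simp [mul_comm]
        · intro x hx
          rw [image_eq_zero_of_notMem_tsupport (fun h => hx (hφt h).1), mul_zero]
      have h2 := hW1 i φ hφ hφc
      have h3 : ∫ x in Ω₂, w x * fderiv ℝ φ x (EuclideanSpace.single i 1) = 0 := by
        rw [setIntegral_eq_integral_of_forall_compl_eq_zero]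
        · refine integral_eq_zero_of_ae ?_
          filter_upwards [hw0] with x hx
          by_cases hxt : x ∈ tsupport φ
          · simp [hx (hφt hxt)]
          · have : x ∉ tsupport (fun x => fderiv ℝ φ x (EuclideanSpace.single i 1)) := fun h => hxt (rg_pd_ts _ _ h)
            have h0 : fderiv ℝ φ x (EuclideanSpace.single i 1) = 0 :=
              image_eq_zero_of_notMem_tsupport (f := fun x => fderiv ℝ φ x (EuclideanSpace.single i 1)) this
            simp [h0]
        · intro x hx
          have : x ∉ tsupport (fun x => fderiv ℝ φ x (EuclideanSpace.single i 1)) := fun h => hx (hφt (rg_pd_ts _ _ h)).1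
          have h0 : fderiv ℝ φ x (EuclideanSpace.single i 1) = 0 :=
            image_eq_zero_of_notMem_tsupport (f := fun x => fderiv ℝ φ x (EuclideanSpace.single i 1)) this
          rw [h0, mul_zero]
      rw [h1]; linarith
  have t0 : ∀ {f h : EuclideanSpace ℝ (Fin n) → ℝ},
      (∀ᵐ x ∂volume, x ∈ Ω₂ \ closure Ω₁ → f x = 0) →
      ∫ x in Ω₂, f x * h x = ∫ x in Ω₁, f x * h x := by
    intro f h hf
    apply htr
    filter_upwards [hf] with x hx hxo
    rw [hx hxo, zero_mul]
  have tv : ∀ {h : EuclideanSpace ℝ (Fin n) → ℝ}, ∫ x in Ω₂, v x * h x = ∫ x in Ω₁, v x * h x := by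
    intro h
    apply t0
    exact Eventually.of_forall fun x hx => hv0 x fun h => hx.2 (subset_closure h)
  have hpdb : ∀ {f : EuclideanSpace ℝ (Fin n) → ℝ} {x C} (i), ‖fderiv ℝ f x‖ ≤ C → |fderiv ℝ f x (e i)| ≤ C := by
    intro f x C i h
    have := (fderiv ℝ f x).le_opNorm (e i)
    rw [hen, mul_one] at this
    exact this.trans h
  -- step 3
  have s3 : ∀ (i : Fin n) (f : EuclideanSpace ℝ (Fin n) → ℝ) (M : ℝ), ContDiffOn ℝ (⊤ : ℕ∞) f Ω₁ →
      (∀ x ∈ Ω₁, |f x| ≤ M) → (∀ x ∈ Ω₁, ‖fderiv ℝ f x‖ ≤ M) →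
      ∫ x in Ω₁, w x * fderiv ℝ f x (e i) = - ∫ x in Ω₁, g i x * f x := by
    intro i f M hf hM hM'
    obtain ⟨F, C, hF, hFc, hFb, hFb', hFl, hFl'⟩ := rg_approx h1open h1bdd h1smooth hf hM hM'
    have l1 := rg_dct hm1 (i1 hw) (F := fun k x => fderiv ℝ (F k) x (e i)) (f := fun x => fderiv ℝ f x (e i))
      (C := C) (fun k => (rg_test_pd (hF k) (e i)).continuous.aestronglyMeasurable)
      (fun k x hx => hpdb i (hFb' k x hx)) (by
        filter_upwards [ae_restrict_mem hm1] with x hx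
        exact ((ContinuousLinearMap.apply ℝ ℝ (e i)).continuous.tendsto _).comp (hFl' x hx))
    have l2 := rg_dct hm1 (i1 (hg i)) (F := F) (f := f)
      (C := C) (fun k => (hF k).continuous.aestronglyMeasurable)
      (fun k x hx => hFb k x hx) (by
        filter_upwards [ae_restrict_mem hm1] with x hx using hFl x hx)
    have heq : ∀ k, ∫ x in Ω₁, w x * fderiv ℝ (F k) x (e i) = - ∫ x in Ω₁, g i x * F k x := by
      intro k
      rw [← t0 hw0, ← t0 (hg0 i)]
      exact hW1 i (F k) (hF k) (hFc k)
    simp only [heq] at l1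
    exact tendsto_nhds_unique l1 l2.neg
  obtain ⟨M, hM⟩ := rg_bdd h1open h1bdd hu
  have huo : ContDiffOn ℝ (⊤ : ℕ∞) u Ω₁ := hu.mono subset_closure
  have hdu : ContDiffOn ℝ (⊤ : ℕ∞) (fderiv ℝ u) Ω₁ := huo.fderiv_of_isOpen h1open (by simp)
  have hddu : ∀ x ∈ Ω₁, DifferentiableAt ℝ (fderiv ℝ u) x := fun x hx =>
    (hdu.contDiffAt (h1open.mem_nhds hx)).differentiableAt (by simp)
  -- step 4
  have hM1 : ∀ x ∈ Ω₁, |u x| ≤ M := fun x hx => (hM x hx).1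
  have hM2 : ∀ x ∈ Ω₁, ‖fderiv ℝ u x‖ ≤ M := fun x hx => (hM x hx).2.1
  have hM3 : ∀ i, ∀ x ∈ Ω₁, ‖fderiv ℝ (fun y => fderiv ℝ u y (e i)) x‖ ≤ M := by
    intro i x hx
    have hM0 : 0 ≤ M := (abs_nonneg _).trans (hM1 x hx)
    rw [fderiv_clm_apply (hddu x hx) (differentiableAt_const _)]
    refine ContinuousLinearMap.opNorm_le_bound _ hM0 fun y => ?_
    simp only [fderiv_fun_const, Pi.zero_apply, ContinuousLinearMap.comp_zero, zero_add,
      ContinuousLinearMap.flip_apply]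
    refine ((fderiv ℝ (fderiv ℝ u) x y).le_opNorm (e i)).trans ?_
    rw [hen, mul_one]
    exact ((fderiv ℝ (fderiv ℝ u) x).le_opNorm y).trans
      (mul_le_mul_of_nonneg_right (hM x hx).2.2 (norm_nonneg _))
  have s4' := fun i => s3 i (fun y => fderiv ℝ u y (e i)) M
    (hdu.clm_apply contDiffOn_const) (fun x hx => hpdb i (hM2 x hx)) (hM3 i)
  have ib : ∀ {f h : EuclideanSpace ℝ (Fin n) → ℝ} {C : ℝ}, Integrable f (volume.restrict Ω₁) →
      ContinuousOn h Ω₁ → (∀ x ∈ Ω₁, |h x| ≤ C) →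
      Integrable (fun x => f x * h x) (volume.restrict Ω₁) := by
    intro f h C hf hh hC
    refine hf.mul_bdd (c := C) (hh.aestronglyMeasurable hm1) ?_
    filter_upwards [ae_restrict_mem hm1] with x hx using hC x hx
  have s4 : ∑ i, ∫ x in Ω₁, g i x * fderiv ℝ u x (e i) = 0 := by
    have h1 : ∑ i, ∫ x in Ω₁, w x * fderiv ℝ (fun y => fderiv ℝ u y (e i)) x (e i) = 0 := by
      rw [← integral_finsetSum]
      · refine (setIntegral_congr_fun hm1 (g := fun _ => (0:ℝ)) ?_).trans (by simp)
        intro x hx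
        beta_reduce
        rw [← Finset.mul_sum, ← rg_lap (hddu x hx), huharm.2 x hx, mul_zero]
      · intro i _
        refine ib (i1 hw) ?_ (fun x hx => hpdb i (hM3 i x hx))
        exact ((hdu.clm_apply contDiffOn_const).continuousOn_fderiv_of_isOpen h1open
          (by simp)).clm_apply continuousOn_const
    simp only [s4', Finset.sum_neg_distrib] at h1
    linarith
  -- step 5
  have s5 : ∀ (f : EuclideanSpace ℝ (Fin n) → ℝ) (M : ℝ) (K : Set (EuclideanSpace ℝ (Fin n))),
      ContDiffOn ℝ (⊤ : ℕ∞) f Ω₁ →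
      (∀ x ∈ Ω₁, |f x| ≤ M) → (∀ x ∈ Ω₁, ‖fderiv ℝ f x‖ ≤ M) → IsCompact K → K ⊆ Ω₂ →
      (∀ x ∈ Ω₁, f x ≠ 0 → x ∈ K) →
      ∑ i, ∫ x in Ω₁, g i x * fderiv ℝ f x (e i) = ∫ x in Ω₁, v x * f x := by
    intro f M K hf hM hM' hK hKs hfK
    obtain ⟨F, C, hF, hFc, hFb, hFb', hFl, hFl'⟩ := rg_approx h1open h1bdd h1smooth hf hM hM'
    obtain ⟨η, hη, hηc, hηt, hη1⟩ := rg_cutoff hK h2open hKs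
    obtain ⟨A, hA⟩ := h1bdd.isCompact_closure.exists_bound_of_continuousOn hη.continuous.continuousOn
    obtain ⟨B, hB⟩ := h1bdd.isCompact_closure.exists_bound_of_continuousOn
      (hη.continuous_fderiv (by simp)).continuousOn
    have hηf : ∀ x ∈ Ω₁, η x * f x = f x := by
      intro x hx
      by_cases h : f x = 0
      · simp [h]
      · rw [hη1 x (hfK x hx h), one_mul]
    set P : ℕ → EuclideanSpace ℝ (Fin n) → ℝ := fun k x => η x * F k x with hP
    have hPs : ∀ k, ContDiff ℝ (⊤ : ℕ∞) (P k) := fun k => hη.mul (hF k)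
    have hPt : ∀ k, IsTest Ω₂ (P k) := fun k =>
      ⟨hPs k, hηc.mul_right, tsupport_mul_subset_left.trans hηt⟩
    have hPd : ∀ k x, fderiv ℝ (P k) x = η x • fderiv ℝ (F k) x + F k x • fderiv ℝ η x := fun k x =>
      fderiv_fun_mul (hη.differentiable (by simp) x) ((hF k).differentiable (by simp) x)
    have hfd : ∀ x ∈ Ω₁, fderiv ℝ f x = η x • fderiv ℝ f x + f x • fderiv ℝ η x := by
      intro x hx
      rw [← fderiv_fun_mul (hη.differentiable (by simp) x)
        ((hf.contDiffAt (h1open.mem_nhds hx)).differentiableAt (by simp))]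
      apply Filter.EventuallyEq.fderiv_eq
      filter_upwards [h1open.mem_nhds hx] with y hy using (hηf y hy).symm
    have hPb : ∀ k, ∀ x ∈ Ω₁, |P k x| ≤ A * C := by
      intro k x hx
      have h1 := hA x (subset_closure hx)
      rw [Real.norm_eq_abs] at h1
      simp only [hP, abs_mul]
      exact mul_le_mul h1 (hFb k x hx) (abs_nonneg _) ((abs_nonneg _).trans h1)
    have hPb' : ∀ k, ∀ x ∈ Ω₁, ‖fderiv ℝ (P k) x‖ ≤ A * C + C * B := by
      intro k x hx
      have h1 := hA x (subset_closure hx)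
      rw [hPd]
      refine (norm_add_le _ _).trans (add_le_add ?_ ?_)
      · rw [norm_smul]
        exact mul_le_mul h1 (hFb' k x hx) (norm_nonneg _) ((norm_nonneg _).trans h1)
      · rw [norm_smul]
        exact mul_le_mul (hFb k x hx) (hB x (subset_closure hx)) (norm_nonneg _)
          ((abs_nonneg _).trans (hFb k x hx))
    have l1 := fun i => rg_dct hm1 (i1 (hg i)) (F := fun k x => fderiv ℝ (P k) x (e i))
      (f := fun x => fderiv ℝ f x (e i)) (C := A * C + C * B)
      (fun k => (rg_test_pd (hPs k) (e i)).continuous.aestronglyMeasurable)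
      (fun k x hx => hpdb i (hPb' k x hx)) (by
        filter_upwards [ae_restrict_mem hm1] with x hx
        have : Tendsto (fun k => fderiv ℝ (P k) x) atTop (𝓝 (fderiv ℝ f x)) := by
          rw [hfd x hx]
          simp only [hPd]
          exact ((hFl' x hx).const_smul _).add ((hFl x hx).smul_const _)
        exact ((ContinuousLinearMap.apply ℝ ℝ (e i)).continuous.tendsto _).comp this)
    have l2 := rg_dct hm1 (i1 hv) (F := P) (f := f)
      (C := A * C) (fun k => (hPs k).continuous.aestronglyMeasurable)
      (fun k x hx => hPb k x hx) (by
        filter_upwards [ae_restrict_mem hm1] with x hx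
        rw [← hηf x hx]
        exact (hFl x hx).const_mul _)
    have heq : ∀ k, ∑ i, ∫ x in Ω₁, g i x * fderiv ℝ (P k) x (e i) = ∫ x in Ω₁, v x * P k x := by
      intro k
      have h1 := hlap (P k) (hPt k)
      have h2 : ∫ y in Ω₂, w y * lap (P k) y = - ∑ i, ∫ x in Ω₂, g i x * fderiv ℝ (P k) x (e i) := by
        rw [← Finset.sum_neg_distrib]
        have hd : ContDiff ℝ (⊤ : ℕ∞) (fderiv ℝ (P k)) := (hPs k).fderiv_right (by simp)
        have : ∀ y, w y * lap (P k) y =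
            ∑ i, w y * fderiv ℝ (fun z => fderiv ℝ (P k) z (e i)) y (e i) := by
          intro y
          rw [rg_lap (hd.differentiable (by simp) y), Finset.mul_sum]
        simp only [this]
        rw [integral_finsetSum]
        · refine Finset.sum_congr rfl fun i _ => ?_
          exact hW1 i _ (rg_test_pd (hPs k) _) (rg_pd_cs (hPt k).2.1 _)
        · intro i _
          refine rg_im hw ?_
          exact ((rg_test_pd (rg_test_pd (hPs k) _) _).continuous.memLp_of_hasCompactSupport
            (rg_pd_cs (rg_pd_cs (hPt k).2.1 _) _)).restrict Ω₂
      rw [← tv]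
      simp only [← t0 (hg0 _)]
      linarith
    have l3 := tendsto_finsetSum (Finset.univ : Finset (Fin n)) (fun i _ => l1 i)
    simp only [heq] at l3
    exact tendsto_nhds_unique l3 l2
  -- step 6
  obtain ⟨θ, C, hθ, hθ0, hθ2, hθb, hθd, hθd1⟩ := rg_theta
  set c : ℕ → ℝ := fun k => (k : ℝ) + 1 with hc
  have hcpos : ∀ k, 0 < c k := fun k => by simp only [hc]; positivity
  have hctop : Tendsto c atTop atTop := tendsto_atTop_add_const_right _ _ tendsto_natCast_atTop_atTop
  set U : ℕ → EuclideanSpace ℝ (Fin n) → ℝ := fun k x => (c k)⁻¹ * θ (c k * u x) with hU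
  have hUs : ∀ k, ContDiffOn ℝ (⊤ : ℕ∞) (U k) Ω₁ := fun k =>
    contDiffOn_const.mul (hθ.comp_contDiffOn (contDiffOn_const.mul huo))
  have hUb : ∀ k x, |U k x| ≤ |u x| := by
    intro k x
    simp only [hU, abs_mul, abs_inv, abs_of_pos (hcpos k)]
    rw [inv_mul_le_iff₀ (hcpos k)]
    have := hθb (c k * u x)
    rwa [abs_mul, abs_of_pos (hcpos k)] at this
  have hUd : ∀ k, ∀ x ∈ Ω₁, fderiv ℝ (U k) x = deriv θ (c k * u x) • fderiv ℝ u x := by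
    intro k x hx
    have h1 : HasFDerivAt u (fderiv ℝ u x) x :=
      ((huo.contDiffAt (h1open.mem_nhds hx)).differentiableAt (by simp)).hasFDerivAt
    have h2 : HasDerivAt θ (deriv θ (c k * u x)) (c k * u x) :=
      (hθ.differentiable (by simp) _).hasDerivAt
    have h3 := (h2.comp_hasFDerivAt x (h1.const_mul (c k))).const_mul (c k)⁻¹
    have h4 : HasFDerivAt (U k) ((c k)⁻¹ • deriv θ (c k * u x) • c k • fderiv ℝ u x) x := h3
    rw [h4.fderiv, smul_smul, smul_smul]
    congr 1
    field_simp [(hcpos k).ne']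
  have hC0 : 0 ≤ C := (abs_nonneg _).trans (hθd 0)
  have hUdb : ∀ k, ∀ x ∈ Ω₁, ‖fderiv ℝ (U k) x‖ ≤ C * M := by
    intro k x hx
    rw [hUd k x hx, norm_smul]
    exact mul_le_mul (hθd _) (hM2 x hx) (norm_nonneg _) hC0
  have hbig : ∀ x, u x ≠ 0 → ∀ᶠ k in atTop, 2 < |c k * u x| := by
    intro x hx
    have : Tendsto (fun k => c k * |u x|) atTop atTop := hctop.atTop_mul_const (abs_pos.2 hx)
    filter_upwards [this.eventually_gt_atTop 2] with k hk
    rwa [abs_mul, abs_of_pos (hcpos k)]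
  have hUl : ∀ x, Tendsto (fun k => U k x) atTop (𝓝 (u x)) := by
    intro x
    by_cases h : u x = 0
    · have : ∀ k, U k x = 0 := fun k => by simp [hU, h, hθ0 0 (by simp)]
      simp [this, h]
    · refine tendsto_const_nhds.congr' ?_
      filter_upwards [hbig x h] with k hk
      simp only [hU]
      rw [hθ2 _ hk.le, inv_mul_cancel_left₀ (hcpos k).ne']
  have hnull : ∀ᵐ x ∂volume, ¬ (x ∈ Ω₁ ∧ u x = 0 ∧ fderiv ℝ u x ≠ 0) :=
    measure_eq_zero_iff_ae_notMem.1
      (rg_null_level volume h1open (huo.of_le (by exact_mod_cast le_top)))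
  have hUdl : ∀ᵐ x ∂(volume.restrict Ω₁), Tendsto (fun k => fderiv ℝ (U k) x) atTop (𝓝 (fderiv ℝ u x)) := by
    filter_upwards [ae_restrict_mem hm1, ae_restrict_of_ae hnull] with x hx hx'
    by_cases h : u x = 0
    · have h0 : fderiv ℝ u x = 0 := by
        by_contra h'
        exact hx' ⟨hx, h, h'⟩
      have : ∀ k, fderiv ℝ (U k) x = 0 := fun k => by rw [hUd k x hx, h0, smul_zero]
      simp [this, h0]
    · refine tendsto_const_nhds.congr' ?_
      filter_upwards [hbig x h] with k hk
      rw [hUd k x hx, hθd1 _ hk, one_smul]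
  have s6 : ∀ k, ∑ i, ∫ x in Ω₁, g i x * fderiv ℝ (U k) x (e i) = ∫ x in Ω₁, v x * U k x := by
    intro k
    have hcl : IsClosed (closure Ω₁ ∩ u ⁻¹' {t | 1 ≤ c k * |t|}) :=
      hu.continuousOn.preimage_isClosed_of_isClosed isClosed_closure
        (isClosed_le continuous_const (by fun_prop))
    refine s5 (U k) (max M (C * M)) (closure Ω₁ ∩ u ⁻¹' {t | 1 ≤ c k * |t|}) (hUs k)
      (fun x hx => (hUb k x).trans ((hM1 x hx).trans (le_max_left _ _)))
      (fun x hx => (hUdb k x hx).trans (le_max_right _ _))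
      (h1bdd.isCompact_closure.of_isClosed_subset hcl inter_subset_left) ?_ ?_
    · rintro x ⟨hx, hx'⟩
      by_contra hx2
      have hf2 : x ∈ frontier Ω₂ := by
        rw [h2open.frontier_eq]; exact ⟨closure_mono h12 hx, hx2⟩
      have hf1 : x ∈ frontier Ω₁ := by
        rw [h1open.frontier_eq]; exact ⟨hx, fun h => hx2 (h12 h)⟩
      have := hu0 x ⟨hf1, hf2⟩
      simp [this] at hx'
      linarith
    · intro x hx hne
      refine ⟨subset_closure hx, ?_⟩
      by_contra hlt
      simp only [mem_preimage, mem_ofPred_eq, not_le] at hlt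
      apply hne
      simp only [hU]
      rw [hθ0 _ (by rw [abs_mul, abs_of_pos (hcpos k)]; exact hlt.le), mul_zero]
  have l1 := fun i => rg_dct hm1 (i1 (hg i)) (F := fun k x => fderiv ℝ (U k) x (e i))
    (f := fun x => fderiv ℝ u x (e i)) (C := C * M)
    (fun k => (((hUs k).continuousOn_fderiv_of_isOpen h1open
          (by simp)).clm_apply continuousOn_const).aestronglyMeasurable hm1)
    (fun k x hx => hpdb i (hUdb k x hx)) (by
      filter_upwards [hUdl] with x hx
      exact ((ContinuousLinearMap.apply ℝ ℝ (e i)).continuous.tendsto _).comp hx)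
  have l2 := rg_dct hm1 (i1 hv) (F := U) (f := u) (C := M)
    (fun k => (hUs k).continuousOn.aestronglyMeasurable hm1)
    (fun k x hx => (hUb k x).trans (hM1 x hx)) (Eventually.of_forall hUl)
  have l3 := tendsto_finsetSum (Finset.univ : Finset (Fin n)) (fun i _ => l1 i)
  simp only [s6] at l3
  rw [s4] at l3
  exact tendsto_nhds_unique l2 l3

end core2
section pot
open Filter Topology Set

lemma rg_pot {n : ℕ} {Ω₁ Ω₂ : Set (EuclideanSpace ℝ (Fin n))} (h12 : Ω₁ ⊆ Ω₂)
    (h1open : IsOpen Ω₁) (h1bdd : Bornology.IsBounded Ω₁)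
    {G : EuclideanSpace ℝ (Fin n) → EuclideanSpace ℝ (Fin n) → ℝ}
    (hGcont : ContinuousOn (fun p : EuclideanSpace ℝ (Fin n) × EuclideanSpace ℝ (Fin n) =>
      G p.1 p.2) {p | p.1 ∈ closure Ω₂ ∧ p.2 ∈ closure Ω₂ ∧ p.1 ≠ p.2})
    {a : EuclideanSpace ℝ (Fin n) → ℝ} (ha : IsTest (Ω₂ \ closure Ω₁) a) :
    (∀ x ∈ Ω₁, Integrable (fun y => G x y * a y) (volume.restrict Ω₂)) ∧
    MemLp (fun x => ∫ y in Ω₂, G x y * a y) 2 (volume.restrict Ω₁) ∧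
    ∀ v, MemLp v 2 (volume.restrict Ω₁) →
      ∫ x in Ω₁, v x * ∫ y in Ω₂, G x y * a y = ∫ y in Ω₂, (∫ x in Ω₁, G x y * v x) * a y := by
  set K := tsupport a with hK
  have hKc : IsCompact K := ha.2.1
  have hKs : K ⊆ Ω₂ \ closure Ω₁ := ha.2.2
  have hac : Continuous a := ha.1.continuous
  have ha0 : ∀ y, y ∉ K → a y = 0 := fun y hy => image_eq_zero_of_notMem_tsupport hy
  have hm1 := h1open.measurableSet
  have : IsFiniteMeasure (volume.restrict Ω₁) := ⟨by simpa using h1bdd.measure_lt_top⟩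
  have : IsFiniteMeasure (volume.restrict K) := ⟨by simpa using hKc.measure_lt_top⟩
  have hGc : ContinuousOn (fun p : EuclideanSpace ℝ (Fin n) × EuclideanSpace ℝ (Fin n) =>
      G p.1 p.2) (closure Ω₁ ×ˢ K) := by
    refine hGcont.mono ?_
    rintro ⟨x, y⟩ ⟨hx, hy⟩
    refine ⟨closure_mono h12 hx, subset_closure (hKs hy).1, ?_⟩
    intro hxy
    have hxy' : x = y := hxy
    subst hxy'
    exact (hKs hy).2 hx
  obtain ⟨B, hB⟩ := (h1bdd.isCompact_closure.prod hKc).exists_bound_of_continuousOn hGc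
  have hsw : ∀ h : EuclideanSpace ℝ (Fin n) → ℝ, ∫ y in Ω₂, h y * a y = ∫ y in K, h y * a y := by
    intro h
    rw [setIntegral_eq_integral_of_forall_compl_eq_zero,
      setIntegral_eq_integral_of_forall_compl_eq_zero]
    · intro y hy; rw [ha0 y hy, mul_zero]
    · intro y hy; rw [ha0 y (fun h => hy (hKs h).1), mul_zero]
  have hprod : (volume.restrict Ω₁).prod (volume.restrict K) =
      ((volume : Measure (EuclideanSpace ℝ (Fin n))).prod volume).restrict (Ω₁ ×ˢ K) :=
    Measure.prod_restrict _ _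
  have hmp : MeasurableSet (Ω₁ ×ˢ K) := hm1.prod hKc.measurableSet
  have hGm : AEStronglyMeasurable (fun p : EuclideanSpace ℝ (Fin n) × EuclideanSpace ℝ (Fin n) =>
      G p.1 p.2) ((volume.restrict Ω₁).prod (volume.restrict K)) := by
    rw [hprod]
    exact (hGc.mono (prod_mono subset_closure le_rfl)).aestronglyMeasurable hmp
  have hGb : ∀ᵐ p ∂((volume.restrict Ω₁).prod (volume.restrict K)), ‖G p.1 p.2‖ ≤ B := by
    rw [hprod]
    filter_upwards [ae_restrict_mem hmp] with p hp
    exact hB p ⟨subset_closure hp.1, hp.2⟩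
  have haK : Integrable a (volume.restrict K) :=
    (hac.integrable_of_hasCompactSupport ha.2.1).restrict
  refine ⟨?_, ?_, ?_⟩
  · intro x hx
    have h1 : ContinuousOn (fun y => G x y * a y) K := by
      refine ContinuousOn.mul ?_ hac.continuousOn
      exact hGc.comp (f := fun y => (x, y)) (by fun_prop) (fun y hy => ⟨subset_closure hx, hy⟩)
    have h2 : IntegrableOn (fun y => G x y * a y) K := h1.integrableOn_compact hKc
    rw [integrableOn_iff_integrable_of_support_subset] at h2
    · exact h2.restrict
    · intro y hy
      by_contra h
      exact hy (by simp [ha0 y h])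
  · simp only [hsw]
    refine MemLp.of_bound ?_ (∫ y in K, B * |a y|) ?_
    · exact (hGm.mul (hac.comp continuous_snd).aestronglyMeasurable).integral_prod_right'
    · filter_upwards [ae_restrict_mem hm1] with x hx
      refine norm_integral_le_of_norm_le (haK.abs.const_mul B) ?_
      filter_upwards [ae_restrict_mem hKc.measurableSet] with y hy
      rw [norm_mul]
      exact mul_le_mul_of_nonneg_right (hB (x, y) ⟨subset_closure hx, hy⟩) (norm_nonneg _)
  · intro v hv
    rw [hsw]
    simp only [hsw]
    have hvi : Integrable v (volume.restrict Ω₁) := hv.integrable (by norm_num)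
    have hI : Integrable (Function.uncurry fun x y => v x * a y * G x y)
        ((volume.restrict Ω₁).prod (volume.restrict K)) :=
      (hvi.mul_prod haK).mul_bdd (c := B) hGm hGb
    have := integral_integral_swap hI
    calc _ = ∫ x in Ω₁, ∫ y in K, v x * a y * G x y := by
          congr 1; ext x; rw [← integral_const_mul]; congr 1; ext y; ring
      _ = _ := this
      _ = _ := by
          congr 1; ext y; rw [← integral_mul_const]; congr 1; ext x; ring

end pot

/-- **Runge-type approximation lemma.**
Let `Ω₁ ⊆ Ω₂` be bounded open sets with smooth boundaries and let `G` be a Green kernel for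
the Dirichlet Laplacian on `Ω₂`.  Then the potentials `x ↦ ∫_{Ω₂} G(x,y) a(y) dy` of smooth
densities `a` supported in `Ω̄₂ \ Ω₁` are dense, in the `L²(Ω₁)` topology, in the space of
harmonic functions `u ∈ C^∞(Ω̄₁)` vanishing on `∂Ω₁ ∩ ∂Ω₂`. -/
theorem runge_approximation {n : ℕ}
    (Ω₁ Ω₂ : Set (EuclideanSpace ℝ (Fin n))) (h12 : Ω₁ ⊆ Ω₂)
    (h1open : IsOpen Ω₁) (h2open : IsOpen Ω₂)
    (h1bdd : Bornology.IsBounded Ω₁) (h2bdd : Bornology.IsBounded Ω₂)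
    (h1smooth : HasSmoothBoundary Ω₁) (h2smooth : HasSmoothBoundary Ω₂)
    (G : EuclideanSpace ℝ (Fin n) → EuclideanSpace ℝ (Fin n) → ℝ)
    (hGsym : ∀ x y, G x y = G y x)
    (hGcont : ContinuousOn (fun p : EuclideanSpace ℝ (Fin n) × EuclideanSpace ℝ (Fin n) =>
      G p.1 p.2) {p | p.1 ∈ closure Ω₂ ∧ p.2 ∈ closure Ω₂ ∧ p.1 ≠ p.2})
    (hGharm : ∀ x ∈ Ω₂, IsHarmonicOn (fun y => G x y) (Ω₂ \ {x}))
    (hGbdry : ∀ x ∈ Ω₂, ∀ y ∈ frontier Ω₂, G x y = 0)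
    (hGpot : ∀ v : EuclideanSpace ℝ (Fin n) → ℝ, MemLp v 2 (volume.restrict Ω₂) →
      MemH2 Ω₂ (fun y => ∫ x in Ω₂, G x y * v x) ∧
      MemH10 Ω₂ (fun y => ∫ x in Ω₂, G x y * v x) ∧
      (∀ φ, IsTest Ω₂ φ →
        ∫ y in Ω₂, (∫ x in Ω₂, G x y * v x) * lap φ y = - ∫ y in Ω₂, v y * φ y))
    (u : EuclideanSpace ℝ (Fin n) → ℝ)
    (hu : ContDiffOn ℝ (⊤ : ℕ∞) u (closure Ω₁)) (huharm : IsHarmonicOn u Ω₁)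
    (hu0 : ∀ x ∈ frontier Ω₁ ∩ frontier Ω₂, u x = 0)
    (ε : ℝ) (hε : 0 < ε) :
    ∃ a : EuclideanSpace ℝ (Fin n) → ℝ,
      ContDiffOn ℝ (⊤ : ℕ∞) a (closure Ω₂) ∧ Function.support a ⊆ closure Ω₂ \ Ω₁ ∧
      ∫ x in Ω₁, (u x - ∫ y in Ω₂, G x y * a y) ^ 2 < ε := by
  classical
  have hm1 := h1open.measurableSet
  have hfin1 : IsFiniteMeasure (volume.restrict Ω₁) := ⟨by simpa using h1bdd.measure_lt_top⟩
  have hfin2 : IsFiniteMeasure (volume.restrict Ω₂) := ⟨by simpa using h2bdd.measure_lt_top⟩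
  have hpot := fun a (ha : IsTest (Ω₂ \ closure Ω₁) a) => rg_pot h12 h1open h1bdd hGcont ha
  obtain ⟨M, hM⟩ := rg_bdd h1open h1bdd hu
  have hum : MemLp u 2 (volume.restrict Ω₁) := by
    refine MemLp.of_bound ((hu.continuousOn.mono subset_closure).aestronglyMeasurable hm1) M ?_
    filter_upwards [ae_restrict_mem hm1] with x hx using (hM x hx).1
  let S : Submodule ℝ (Lp ℝ 2 (volume.restrict Ω₁)) :=
    { carrier := {f | ∃ a, IsTest (Ω₂ \ closure Ω₁) a ∧
        f =ᵐ[volume.restrict Ω₁] fun x => ∫ y in Ω₂, G x y * a y}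
      add_mem' := by
        rintro f f' ⟨a, ha, hf⟩ ⟨b, hb, hf'⟩
        refine ⟨fun y => a y + b y, ⟨ha.1.add hb.1, ha.2.1.add hb.2.1,
          (tsupport_add a b).trans (Set.union_subset ha.2.2 hb.2.2)⟩, ?_⟩
        filter_upwards [hf, hf', Lp.coeFn_add f f', ae_restrict_mem hm1] with x h1 h2 h3 hx
        rw [h3, Pi.add_apply, h1, h2, ← integral_add ((hpot a ha).1 x hx) ((hpot b hb).1 x hx)]
        simp only [mul_add]
      zero_mem' := by
        refine ⟨fun _ => 0, ⟨contDiff_const, HasCompactSupport.zero, by simp [tsupport]⟩, ?_⟩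
        filter_upwards [Lp.coeFn_zero ℝ 2 (volume.restrict Ω₁)] with x h
        rw [h]; simp
      smul_mem' := by
        rintro c f ⟨a, ha, hf⟩
        refine ⟨fun y => c * a y, ⟨contDiff_const.mul ha.1, ha.2.1.mul_left,
          tsupport_mul_subset_right.trans ha.2.2⟩, ?_⟩
        filter_upwards [hf, Lp.coeFn_smul c f] with x h1 h3
        rw [h3, Pi.smul_apply, h1, smul_eq_mul, ← integral_const_mul]
        congr 1; ext y; ring }
  have hmem : hum.toLp u ∈ S.topologicalClosure := by
    rw [← Submodule.orthogonal_orthogonal_eq_closure, Submodule.mem_orthogonal]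
    intro v hv
    rw [Submodule.mem_orthogonal] at hv
    have hvm : MemLp v 2 (volume.restrict Ω₁) := Lp.memLp v
    have hv'm : MemLp (Ω₁.indicator v) 2 (volume.restrict Ω₂) := by
      rw [memLp_indicator_iff_restrict hm1, Measure.restrict_restrict_of_subset h12]
      exact hvm
    obtain ⟨-, h10, hlap⟩ := hGpot _ hv'm
    have hweq : ∀ y, ∫ x in Ω₂, G x y * Ω₁.indicator v x = ∫ x in Ω₁, G x y * v x := by
      intro y
      have : ∀ x, G x y * Ω₁.indicator v x = Ω₁.indicator (fun x => G x y * v x) x := by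
        intro x
        by_cases h : x ∈ Ω₁ <;> simp [h]
      simp only [this]
      rw [setIntegral_indicator hm1, Set.inter_eq_self_of_subset_right h12]
    obtain ⟨g, φ, hw, hg, hφ, hl⟩ := h10
    have hw0 : ∀ᵐ x ∂volume, x ∈ Ω₂ \ closure Ω₁ →
        (fun y => ∫ x in Ω₂, G x y * Ω₁.indicator v x) x = 0 := by
      refine (h2open.sdiff isClosed_closure).ae_eq_zero_of_integral_contDiff_smul_eq_zero ?_ ?_
      · have : IntegrableOn (fun y => ∫ x in Ω₂, G x y * Ω₁.indicator v x) Ω₂ volume :=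
          hw.integrable (by norm_num)
        exact (this.mono_set Set.sdiff_subset).locallyIntegrableOn
      · intro a ha hac hat
        have hta : IsTest (Ω₂ \ closure Ω₁) a := ⟨ha, hac, hat⟩
        have h1 : ∫ y, a y • (∫ x in Ω₂, G x y * Ω₁.indicator v x) =
            ∫ y in Ω₂, (∫ x in Ω₁, G x y * v x) * a y := by
          rw [setIntegral_eq_integral_of_forall_compl_eq_zero]
          · congr 1; ext y; rw [hweq, smul_eq_mul, mul_comm]
          · intro y hy
            rw [image_eq_zero_of_notMem_tsupport (fun h => hy (hat h).1), mul_zero]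
        rw [h1, ← (hpot a hta).2.2 v hvm]
        have hPm := (hpot a hta).2.1
        have h2 := hv (hPm.toLp _) ⟨a, hta, hPm.coeFn_toLp⟩
        rw [L2.inner_def] at h2
        rw [← h2]
        refine integral_congr_ae ?_
        filter_upwards [hPm.coeFn_toLp] with x hx
        rw [hx]; simp
    have hcore := rg_core h12 h1open h2open h1bdd h2bdd h1smooth hw (fun i => (hg i).1) hv'm
      (fun x hx => Set.indicator_of_notMem hx _)
      (fun i ψ h1 h2 => rg_W1 hw (fun i => (hg i).1) hφ hl i h1 h2) hlap hw0 hu huharm hu0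
    rw [L2.inner_def, ← hcore]
    refine integral_congr_ae ?_
    filter_upwards [hum.coeFn_toLp, ae_restrict_mem hm1] with x hx hxm
    rw [hx, Set.indicator_of_mem hxm]; simp [mul_comm]
  have hmem' : hum.toLp u ∈ closure (S : Set (Lp ℝ 2 (volume.restrict Ω₁))) := hmem
  obtain ⟨f, ⟨a, ha, hfa⟩, hdist⟩ := Metric.mem_closure_iff.1 hmem' (Real.sqrt ε) (Real.sqrt_pos.2 hε)
  refine ⟨a, ha.1.contDiffOn, ?_, ?_⟩
  · intro x hx
    have := ha.2.2 (subset_tsupport a hx)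
    exact ⟨subset_closure this.1, fun h => this.2 (subset_closure h)⟩
  · have h1 : ∫ x in Ω₁, (u x - ∫ y in Ω₂, G x y * a y) ^ 2 = ‖hum.toLp u - f‖ ^ 2 := by
      rw [← real_inner_self_eq_norm_sq, L2.inner_def]
      refine integral_congr_ae ?_
      filter_upwards [hum.coeFn_toLp, hfa, Lp.coeFn_sub (hum.toLp u) f] with x h1 h2 h3
      rw [h3, Pi.sub_apply, h1, h2]; simp [sq]
    rw [h1, ← dist_eq_norm]
    calc _ < Real.sqrt ε ^ 2 := pow_lt_pow_left₀ hdist dist_nonneg (by norm_num)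
      _ = ε := Real.sq_sqrt hε.le


end
end

section
/- Let f : ℝⁿ → ℂ be a bounded measurable function supported in the half-space {y ∈ ℝⁿ : y₁ ≤ 0}. Then for every h > 0 and every z ∈ ℂⁿ with Re z₁ ≥ 0, the Segal–Bargmann transform satisfies |Tf(z)| ≤ (2πh)^{n/2} e^{(|Im z|² − (Re z₁)²)/(2h)} ‖f‖_{L^∞}. -/
open MeasureTheory Real

noncomputable section

/-- The Segal–Bargmann transform of `f : ℝⁿ → ℂ` at semiclassical parameter `h`:
`Tf(z) = ∫ e^{-(z-y)²/(2h)} f(y) dy`, where `(z-y)² = Σⱼ (zⱼ-yⱼ)²` is the bilinear square. -/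
def SegalBargmann {n : ℕ} (h : ℝ) (f : EuclideanSpace ℝ (Fin n) → ℂ)
    (z : EuclideanSpace ℂ (Fin n)) : ℂ :=
  ∫ y : EuclideanSpace ℝ (Fin n),
    Complex.exp (-(∑ j, (z j - (y j : ℂ)) ^ 2) / (2 * h)) * f y

/-- **Improved bound for the Segal–Bargmann transform of a half-space supported function.**
If the bounded measurable `f : ℝⁿ → ℂ` is supported in `{y₁ ≤ 0}`, then for `Re z₁ ≥ 0`,
`|Tf(z)| ≤ (2πh)^{n/2} e^{(|Im z|² - (Re z₁)²)/(2h)} ‖f‖_∞`. -/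
theorem segalBargmann_halfspace_bound {n : ℕ} (hn : 0 < n)
    (f : EuclideanSpace ℝ (Fin n) → ℂ)
    (hf : MemLp f ⊤ (volume : Measure (EuclideanSpace ℝ (Fin n))))
    (hsupp : ∀ y : EuclideanSpace ℝ (Fin n), 0 < y ⟨0, hn⟩ → f y = 0)
    (h : ℝ) (hh : 0 < h) (z : EuclideanSpace ℂ (Fin n)) (hz : 0 ≤ (z ⟨0, hn⟩).re) :
    ‖SegalBargmann h f z‖ ≤
      (2 * π * h) ^ ((n : ℝ) / 2) *
        Real.exp (((∑ j, (z j).im ^ 2) - (z ⟨0, hn⟩).re ^ 2) / (2 * h)) *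
        (eLpNorm f ⊤ volume).toReal := by
  set w : EuclideanSpace ℝ (Fin n) :=
    WithLp.toLp 2 (fun j => if j = ⟨0, hn⟩ then 0 else (z j).re) with hw
  set C : ℝ := Real.exp (((∑ j, (z j).im ^ 2) - (z ⟨0, hn⟩).re ^ 2) / (2 * h)) with hC
  set M : ℝ := (eLpNorm f ⊤ volume).toReal with hM
  have hb : 0 < 1 / (2 * h) := by positivity
  have hG : ∫ y : EuclideanSpace ℝ (Fin n), Real.exp (-(1 / (2 * h)) * ‖y - w‖ ^ 2)
      = (2 * π * h) ^ ((n : ℝ) / 2) := by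
    rw [integral_sub_right_eq_self
      (fun y : EuclideanSpace ℝ (Fin n) => Real.exp (-(1 / (2 * h)) * ‖y‖ ^ 2)) w,
      GaussianFourier.integral_rexp_neg_mul_sq_norm hb]
    simp only [finrank_euclideanSpace, Fintype.card_fin]
    congr 1
    field_simp
  have hGpos : 0 < (2 * π * h) ^ ((n : ℝ) / 2) := by positivity
  have hGi : Integrable
      (fun y : EuclideanSpace ℝ (Fin n) => Real.exp (-(1 / (2 * h)) * ‖y - w‖ ^ 2)) := by
    apply Integrable.of_integral_ne_zero
    rw [hG]; exact hGpos.ne'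
  have hfM : ∀ᵐ y : EuclideanSpace ℝ (Fin n), ‖f y‖ ≤ M := by
    have hfin : eLpNorm f ⊤ volume ≠ ⊤ := hf.2.ne
    have := ae_le_eLpNormEssSup (f := f) (μ := (volume : Measure (EuclideanSpace ℝ (Fin n))))
    filter_upwards [this] with y hy
    rw [← eLpNorm_exponent_top] at hy
    have := ENNReal.toReal_mono hfin hy
    rwa [toReal_enorm] at this
  have hmain : ‖SegalBargmann h f z‖ ≤ ∫ y : EuclideanSpace ℝ (Fin n),
      Real.exp (-(1 / (2 * h)) * ‖y - w‖ ^ 2) * (C * M) := by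
    unfold SegalBargmann
    apply norm_integral_le_of_norm_le (hGi.mul_const _)
    filter_upwards [hfM] with y hy
    have hM0 : 0 ≤ M := ENNReal.toReal_nonneg
    by_cases hy0 : 0 < y ⟨0, hn⟩
    · rw [hsupp y hy0]
      simp only [mul_zero, norm_zero]
      positivity
    · push Not at hy0
      rw [norm_mul, ← mul_assoc]
      refine mul_le_mul ?_ hy (norm_nonneg _) (by positivity)
      rw [Complex.norm_exp, hC, ← Real.exp_add]
      apply Real.exp_le_exp.mpr
      have hre : (-(∑ j, (z j - (y j : ℂ)) ^ 2) / (2 * (h : ℂ))).re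
          = -(∑ j, (((z j).re - y j) ^ 2 - (z j).im ^ 2)) / (2 * h) := by
        have : (2 * (h : ℂ)) = ((2 * h : ℝ) : ℂ) := by push_cast; rfl
        rw [this, Complex.div_ofReal_re, Complex.neg_re, Complex.re_sum]
        congr 2
        apply Finset.sum_congr rfl
        intro j _
        simp [pow_two, Complex.mul_re]
      rw [hre, EuclideanSpace.norm_sq_eq]
      have hkey : ∑ j, ‖(y - w) j‖ ^ 2 + (z ⟨0, hn⟩).re ^ 2
          ≤ ∑ j, ((z j).re - y j) ^ 2 := by
        rw [← Finset.add_sum_erase _ _ (Finset.mem_univ (⟨0, hn⟩ : Fin n)),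
          ← Finset.add_sum_erase _ (fun j => ((z j).re - y j) ^ 2)
            (Finset.mem_univ (⟨0, hn⟩ : Fin n))]
        have : ∑ j ∈ Finset.univ.erase (⟨0, hn⟩ : Fin n), ‖(y - w) j‖ ^ 2
            = ∑ j ∈ Finset.univ.erase (⟨0, hn⟩ : Fin n), ((z j).re - y j) ^ 2 := by
          apply Finset.sum_congr rfl
          intro j hj
          have hj' := Finset.ne_of_mem_erase hj
          simp only [hw, PiLp.sub_apply, if_neg hj', Real.norm_eq_abs, sq_abs]
          ring
        rw [this]
        have h0 : ‖(y - w) ⟨0, hn⟩‖ ^ 2 = (y ⟨0, hn⟩) ^ 2 := by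
          simp [hw]
        rw [h0]
        nlinarith [mul_nonneg hz (neg_nonneg.mpr hy0)]
      rw [Finset.sum_sub_distrib]
      have := mul_le_mul_of_nonneg_left hkey hb.le
      have e : ∀ a : ℝ, a / (2 * h) = 1 / (2 * h) * a := fun a => by ring
      rw [e (-_), e (_ - _)]
      linarith
  rw [integral_mul_const, hG, ← mul_assoc] at hmain
  exact hmain

end
end

section
/- Let n ≥ 2 and set γ = i e₁ + e₂ ∈ ℂⁿ, where e₁, e₂ are the first two standard basis vectors. There exist constants ε₀ > 0 and C > 0 such that for every ε ∈ (0, ε₀], every a > 0, and every z ∈ ℂⁿ with |z − 2ai e₁| < 2εa, there exist ζ, η ∈ ℂⁿ with ζ·ζ = 0, η·η = 0, z = ζ + η, |ζ − aγ| < Cεa, and |η + a\bar{γ}| < Cεa. -/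
open MeasureTheory Real

noncomputable section

lemma exists_root_near (a : ℝ) (ha : 0 < a) (q : ℂ) (K : ℝ) (h : ‖q - (a:ℂ)^2‖ ≤ K * a) :
    ∃ s : ℂ, s ^ 2 = q ∧ ‖s - a‖ ≤ K := by
  obtain ⟨s, hs, hre⟩ : ∃ s : ℂ, s ^ 2 = q ∧ 0 ≤ s.re := by
    obtain ⟨s, hs⟩ := IsAlgClosed.exists_pow_nat_eq q (n := 2) (by norm_num)
    rcases le_total 0 s.re with h | h
    · exact ⟨s, hs, h⟩
    · exact ⟨-s, by rw [neg_sq, hs], by simpa using h⟩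
  refine ⟨s, hs, ?_⟩
  have h1 : a ≤ ‖s + a‖ := by
    have := Complex.re_le_norm (s + a)
    simp at this
    linarith
  have h2 : ‖s - a‖ * ‖s + a‖ ≤ K * a := by
    rw [← norm_mul]
    convert h using 2
    rw [← hs]; ring
  have h3 : ‖s - a‖ * a ≤ K * a := le_trans (by gcongr) h2
  exact le_of_mul_le_mul_right h3 ha

lemma scalar_part (a d : ℝ) (ha : 0 < a) (hda : d ≤ a / 2) (u z2 R : ℂ)
    (hu : ‖u‖ ≤ d) (hz2 : ‖z2‖ ≤ d) (hR : ‖R‖ ≤ 3 * d ^ 2) :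
    ∃ s t : ℂ, (2 * a * Complex.I + u) * t + z2 * s = 0 ∧
      t ^ 2 + s ^ 2 = -((2 * a * Complex.I + u) ^ 2 + z2 ^ 2 + R) / 4 ∧
      ‖s - a‖ ≤ 2 * d ∧ ‖t‖ ≤ 2 * d := by
  have hd : 0 ≤ d := le_trans (norm_nonneg _) hu
  obtain ⟨z1, hz1⟩ : ∃ z1, z1 = 2 * a * Complex.I + u := ⟨_, rfl⟩
  rw [← hz1]
  have hn1 : 3 / 2 * a ≤ ‖z1‖ := by
    have h := norm_sub_le z1 u
    have h' : ‖z1 - u‖ = 2 * a := by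
      rw [hz1]; simp [abs_of_pos ha]
    linarith
  have hz10 : z1 ≠ 0 := by
    rw [← norm_pos_iff]; linarith
  have hD : ‖z1‖ ^ 2 / 2 ≤ ‖z1 ^ 2 + z2 ^ 2‖ := by
    have h := norm_sub_le (z1 ^ 2 + z2 ^ 2) (z2 ^ 2)
    rw [add_sub_cancel_right, norm_pow, norm_pow] at h
    have h2 : ‖z2‖ ^ 2 ≤ (a / 2) ^ 2 := by gcongr; linarith
    have h3 : (3 / 2 * a) ^ 2 ≤ ‖z1‖ ^ 2 := by gcongr
    nlinarith
  have hDpos : 0 < ‖z1 ^ 2 + z2 ^ 2‖ := lt_of_lt_of_le (by positivity) hD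
  have hD0 : z1 ^ 2 + z2 ^ 2 ≠ 0 := norm_pos_iff.1 hDpos
  have hthird : ‖R * z1 ^ 2 / (4 * (z1 ^ 2 + z2 ^ 2))‖ ≤ 3 / 2 * d ^ 2 := by
    rw [norm_div, norm_mul, norm_mul, norm_pow, div_le_iff₀ (by simpa using hDpos)]
    have : ‖(4:ℂ)‖ = 4 := by simp
    rw [this]
    have := mul_le_mul hR hD (by positivity) (by positivity)
    nlinarith
  obtain ⟨s, hs, hsa⟩ := exists_root_near a ha
    (-(z1 ^ 2 + z2 ^ 2 + R) * z1 ^ 2 / (4 * (z1 ^ 2 + z2 ^ 2))) (2 * d) (by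
      have e : -(z1 ^ 2 + z2 ^ 2 + R) * z1 ^ 2 / (4 * (z1 ^ 2 + z2 ^ 2)) - (a:ℂ) ^ 2
          = (-(a * Complex.I * u) - u ^ 2 / 4) - R * z1 ^ 2 / (4 * (z1 ^ 2 + z2 ^ 2)) := by
        have e1 : -(z1 ^ 2 + z2 ^ 2 + R) * z1 ^ 2 / (4 * (z1 ^ 2 + z2 ^ 2))
          = - z1 ^ 2 / 4 - R * z1 ^ 2 / (4 * (z1 ^ 2 + z2 ^ 2)) := by
          field_simp
          ring
        have e2 : - z1 ^ 2 / 4 - (a:ℂ) ^ 2 = -(a * Complex.I * u) - u ^ 2 / 4 := by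
          rw [hz1]
          linear_combination (-(a:ℂ) ^ 2) * Complex.I_sq
        rw [e1, ← e2]; ring
      rw [e]
      have h1 := norm_sub_le (-(a * Complex.I * u) - u ^ 2 / 4)
        (R * z1 ^ 2 / (4 * (z1 ^ 2 + z2 ^ 2)))
      have h2 := norm_sub_le (-(a * Complex.I * u)) (u ^ 2 / 4)
      have h3 : ‖-(a * Complex.I * u)‖ = a * ‖u‖ := by simp [abs_of_pos ha]
      have h4 : ‖u ^ 2 / 4‖ = ‖u‖ ^ 2 / 4 := by simp
      have h5 : ‖u‖ ^ 2 ≤ d ^ 2 := by gcongr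
      have h6 : a * ‖u‖ ≤ a * d := by gcongr
      have h7 : d ^ 2 ≤ d * (a / 2) := by rw [sq]; gcongr
      nlinarith)
  refine ⟨s, -(s * z2) / z1, ?_, ?_, hsa, ?_⟩
  · field_simp; ring
  · have : (-(s * z2) / z1) ^ 2 + s ^ 2 = s ^ 2 * ((z1 ^ 2 + z2 ^ 2) / z1 ^ 2) := by
      field_simp; ring
    rw [this, hs]
    field_simp
  · rw [norm_div, norm_neg, norm_mul, div_le_iff₀ (by linarith)]
    have h1 : ‖s‖ ≤ 2 * a := by
      have := norm_add_le (s - a) (a : ℂ)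
      simp [abs_of_pos ha] at this
      linarith
    have := mul_le_mul h1 hz2 (norm_nonneg _) (by positivity)
    nlinarith

lemma sum_null {n : ℕ} (i j : Fin n) (hij : i ≠ j) (z : EuclideanSpace ℂ (Fin n)) (s t : ℂ)
    (h1 : z i * t + z j * s = 0) (h2 : t ^ 2 + s ^ 2 = -(∑ k, z k ^ 2) / 4) :
    ∑ k, ((1 / 2 : ℂ) • z + (EuclideanSpace.single i t + EuclideanSpace.single j s)) k ^ 2 = 0 := by
  have key : ∀ k, ((1 / 2 : ℂ) • z +
      (EuclideanSpace.single i t + EuclideanSpace.single j s)) k ^ 2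
      = z k ^ 2 / 4 + (if k = i then z i * t + t ^ 2 else 0)
        + (if k = j then z j * s + s ^ 2 else 0) := by
    intro k
    by_cases hi : k = i
    · subst hi
      simp [hij]; ring
    · by_cases hj : k = j
      · subst hj
        simp [hi]; ring
      · simp [hi, hj]; ring
  rw [Finset.sum_congr rfl (fun k _ => key k)]
  simp only [Finset.sum_add_distrib, Finset.sum_ite_eq', Finset.mem_univ, if_true,
    ← Finset.sum_div]
  linear_combination h1 + h2

/-- **Decomposition into null frequencies.**
With `γ = i e₁ + e₂ ∈ ℂⁿ` (`n ≥ 2`), every `z ∈ ℂⁿ` with `|z - 2ai e₁| < 2εa` splits as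
`z = ζ + η` with `ζ·ζ = η·η = 0`, `|ζ - aγ| < Cεa` and `|η + aγ̄| < Cεa`, for `ε` small. -/
theorem null_frequency_decomposition {n : ℕ} (hn : 2 ≤ n) :
    ∃ ε₀ > (0 : ℝ), ∃ C > (0 : ℝ),
      ∀ ε : ℝ, 0 < ε → ε ≤ ε₀ → ∀ a : ℝ, 0 < a →
        ∀ z : EuclideanSpace ℂ (Fin n),
          ‖z - EuclideanSpace.single (⟨0, by omega⟩ : Fin n) (2 * a * Complex.I)‖ < 2 * ε * a →
          ∃ ζ η : EuclideanSpace ℂ (Fin n),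
            (∑ j, ζ j ^ 2) = 0 ∧ (∑ j, η j ^ 2) = 0 ∧ z = ζ + η ∧
            ‖ζ - a • (EuclideanSpace.single (⟨0, by omega⟩ : Fin n) Complex.I +
              EuclideanSpace.single (⟨1, by omega⟩ : Fin n) 1)‖ < C * ε * a ∧
            ‖η + a • (EuclideanSpace.single (⟨0, by omega⟩ : Fin n) (-Complex.I) +
              EuclideanSpace.single (⟨1, by omega⟩ : Fin n) 1)‖ < C * ε * a := by
  refine ⟨1 / 4, by norm_num, 10, by norm_num, ?_⟩
  intro ε hε hε4 a ha z hz
  generalize hi : (⟨0, by omega⟩ : Fin n) = i at *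
  generalize hj : (⟨1, by omega⟩ : Fin n) = j at *
  have hij : i ≠ j := by rw [← hi, ← hj]; simp
  obtain ⟨y, hy⟩ : ∃ y, y = z - EuclideanSpace.single i (2 * a * Complex.I) := ⟨_, rfl⟩
  rw [← hy] at hz
  obtain ⟨d, hd⟩ : ∃ d, d = 2 * ε * a := ⟨_, rfl⟩
  rw [← hd] at hz
  have hdpos : 0 < d := by rw [hd]; positivity
  have hda : d ≤ a / 2 := by rw [hd]; nlinarith
  have hzy : z = y + EuclideanSpace.single i (2 * a * Complex.I) := by rw [hy]; simp
  have hyk : ∀ k, ‖y k‖ ≤ d := fun k => (PiLp.norm_apply_le y k).trans hz.le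
  have hzi : z i = 2 * a * Complex.I + y i := by rw [hzy]; simp [add_comm]
  have hzj : z j = y j := by rw [hzy]; simp [hij.symm]
  have hsum : ∑ k, z k ^ 2 = ∑ k, y k ^ 2 + (z i ^ 2 - y i ^ 2) := by
    have : ∀ k, z k ^ 2 = y k ^ 2 + (if k = i then z i ^ 2 - y i ^ 2 else 0) := by
      intro k
      by_cases h : k = i
      · subst h; simp
      · have : z k = y k := by rw [hzy]; simp [h]
        simp [h, this]
    rw [Finset.sum_congr rfl (fun k _ => this k)]
    simp [Finset.sum_add_distrib]
  have hR : ‖∑ k, y k ^ 2 - y i ^ 2 - y j ^ 2‖ ≤ 3 * d ^ 2 := by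
    have h1 := norm_sub_le (∑ k, y k ^ 2 - y i ^ 2) (y j ^ 2)
    have h2 := norm_sub_le (∑ k, y k ^ 2) (y i ^ 2)
    have h3 : ‖∑ k, y k ^ 2‖ ≤ ‖y‖ ^ 2 := by
      rw [EuclideanSpace.norm_sq_eq]
      refine (norm_sum_le _ _).trans (le_of_eq ?_)
      simp
    have h4 : ‖y‖ ^ 2 ≤ d ^ 2 := by gcongr
    have h5 : ‖y i ^ 2‖ ≤ d ^ 2 := by rw [norm_pow]; gcongr; exact hyk i
    have h6 : ‖y j ^ 2‖ ≤ d ^ 2 := by rw [norm_pow]; gcongr; exact hyk j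
    linarith
  obtain ⟨s, t, hst, hst2, hs, ht⟩ := scalar_part a d ha hda (y i) (y j) _ (hyk i) (hyk j) hR
  rw [← hzi, ← hzj] at hst
  have hst2' : t ^ 2 + s ^ 2 = -(∑ k, z k ^ 2) / 4 := by
    rw [hst2, hsum, ← hzi]; ring
  have hbound : ∀ w : EuclideanSpace ℂ (Fin n), ∀ s' t' : ℂ, ‖s'‖ ≤ 2 * d → ‖t'‖ ≤ 2 * d →
      w = (1 / 2 : ℂ) • y + (EuclideanSpace.single i t' + EuclideanSpace.single j s') →
      ‖w‖ < 10 * ε * a := by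
    intro w s' t' hs' ht' hw
    have h1 := norm_add_le ((1 / 2 : ℂ) • y)
      (EuclideanSpace.single i t' + EuclideanSpace.single j s')
    have h2 := norm_add_le (EuclideanSpace.single i t') (EuclideanSpace.single j s')
    rw [EuclideanSpace.norm_single, EuclideanSpace.norm_single] at h2
    have h3 : ‖(1 / 2 : ℂ) • y‖ = 1 / 2 * ‖y‖ := by rw [norm_smul]; simp
    rw [← hw] at h1
    linarith
  refine ⟨(1 / 2 : ℂ) • z + (EuclideanSpace.single i t + EuclideanSpace.single j s),
    (1 / 2 : ℂ) • z + (EuclideanSpace.single i (-t) + EuclideanSpace.single j (-s)),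
    sum_null i j hij z s t hst hst2',
    sum_null i j hij z (-s) (-t) (by linear_combination -hst) (by rw [neg_sq, neg_sq, hst2']),
    ?_, ?_, ?_⟩
  · ext k
    by_cases h : k = i <;> by_cases h' : k = j <;> simp [h, h', hij, hij.symm] <;> ring
  · refine hbound _ (s - a) t hs ht ?_
    rw [hzy]
    ext k
    by_cases h : k = i <;> by_cases h' : k = j <;> simp [h, h', hij, hij.symm] <;> ring
  · refine hbound _ (-(s - a)) (-t) (by rwa [norm_neg]) (by rwa [norm_neg]) ?_
    rw [hzy]
    ext k
    by_cases h : k = i <;> by_cases h' : k = j <;> simp [h, h', hij, hij.symm] <;> ring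

end
end

section
/- Define Φ : ℂ → ℝ by Φ(s) = (Im s)² if Re s ≤ 0 and Φ(s) = (Im s)² − (Re s)² if Re s ≥ 0. Let c > 0, 0 < b < L, and r ≥ 0. Then there exist constants c' > 0 and δ > 0 such that for every h ∈ (0,1] and every entire function F : ℂ → ℂ satisfying |F(s)| ≤ e^{Φ(s)/(2h)} for all s ∈ ℂ and |F(s)| ≤ e^{(Φ(s) − c)/(2h)} for all s with |s − L| ≤ b, one has |F(s)| ≤ e^{(Φ(s) − c')/(2h)} for all s ∈ ℂ with |Re s| ≤ δ and |Im s| ≤ r. -/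
open MeasureTheory Real

noncomputable section

/-- The weight `Φ(s) = (Im s)²` for `Re s ≤ 0` and `Φ(s) = (Im s)² - (Re s)²` for
`Re s ≥ 0` (the two formulas agree when `Re s = 0`). -/
def SBweight (s : ℂ) : ℝ := if s.re ≤ 0 then s.im ^ 2 else s.im ^ 2 - s.re ^ 2


open Filter Topology in
theorem key_int (G : ℂ → ℂ) (hG : Differentiable ℂ G) (e L b a m Q : ℝ) (he : 0 < e)
    (hb : 0 < b) (hbL : b < L) (ha : 0 ≤ a) (hQ : (2 * L + 2 * e + b) / b ≤ Q)
    (h1 : ∀ s : ℂ, -e ≤ s.re → ‖G s‖ ≤ Real.exp a)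
    (h2 : ∀ s : ℂ, ‖s - (L : ℂ)‖ ≤ b → ‖G s‖ ≤ Real.exp (-m))
    (n k : ℕ) (hnk : n * Real.log Q ≤ k * m) (s : ℂ) (hs : -e < s.re)
    (hsb : b < ‖s - (L : ℂ)‖) :
    ‖G s‖ ^ k * ‖(s + ((L + 2 * e : ℝ) : ℂ)) / (s - (L : ℂ))‖ ^ n ≤ Real.exp (k * a) := by
  have hL : 0 < L := hb.trans hbL
  have hQ0 : 0 < Q := lt_of_lt_of_le (by positivity) hQ
  have lim : Tendsto (fun R : ℝ => Real.exp (k * a) * (1 + (2 * L + 2 * e) / (R - L)) ^ n)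
      atTop (𝓝 (Real.exp (k * a) * (1 + 0) ^ n)) := by
    refine Tendsto.const_mul _ (Tendsto.pow (Tendsto.const_add _ ?_) n)
    exact Tendsto.div_atTop tendsto_const_nhds (tendsto_atTop_add_const_right _ _ tendsto_id)
  have : ‖G s‖ ^ k * ‖(s + ((L + 2 * e : ℝ) : ℂ)) / (s - (L : ℂ))‖ ^ n
      ≤ Real.exp (k * a) * (1 + 0) ^ n := by
    refine ge_of_tendsto lim ?_
    filter_upwards [eventually_gt_atTop (max ‖s‖ L)] with R hR
    have hRs : ‖s‖ < R := lt_of_le_of_lt (le_max_left _ _) hR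
    have hRL : L < R := lt_of_le_of_lt (le_max_right _ _) hR
    set U : Set ℂ := {z | -e < z.re ∧ b < ‖z - (L : ℂ)‖ ∧ ‖z‖ < R} with hU
    set K : ℂ → ℂ := fun z => G z ^ k * ((z + ((L + 2 * e : ℝ) : ℂ)) / (z - (L : ℂ))) ^ n with hK
    have hUo : IsOpen U := by
      refine IsOpen.inter (isOpen_lt continuous_const Complex.continuous_re) (IsOpen.inter ?_ ?_)
      · exact isOpen_lt continuous_const (continuous_id.sub continuous_const).norm
      · exact isOpen_lt continuous_norm continuous_const
    have hUc : closure U ⊆ {z | -e ≤ z.re ∧ b ≤ ‖z - (L : ℂ)‖ ∧ ‖z‖ ≤ R} := by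
      refine closure_minimal (fun z hz => ⟨hz.1.le, hz.2.1.le, hz.2.2.le⟩) ?_
      refine IsClosed.inter (isClosed_le continuous_const Complex.continuous_re)
        (IsClosed.inter ?_ ?_)
      · exact isClosed_le continuous_const (continuous_id.sub continuous_const).norm
      · exact isClosed_le continuous_norm continuous_const
    have hUb : Bornology.IsBounded U := by
      refine Metric.isBounded_ball (x := (0 : ℂ)) (r := R) |>.subset ?_
      intro z hz
      simpa using hz.2.2
    have hd : DiffContOnCl ℂ K U := by
      apply DifferentiableOn.diffContOnCl
      intro z hz
      have hz' := (hUc hz).2.1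
      have hne : z - (L : ℂ) ≠ 0 := by
        intro h0
        rw [h0, norm_zero] at hz'
        linarith
      have : DifferentiableAt ℂ K z := by
        have := hG z
        fun_prop (disch := assumption)
      exact this.differentiableWithinAt
    have hfac : 1 ≤ 1 + (2 * L + 2 * e) / (R - L) := by
      have : 0 < R - L := by linarith
      have : 0 ≤ (2 * L + 2 * e) / (R - L) := by positivity
      linarith
    have hbd : ∀ z ∈ frontier U, ‖K z‖ ≤ Real.exp (k * a) * (1 + (2 * L + 2 * e) / (R - L)) ^ n := by
      intro z hz
      have hzc := hUc hz.1
      have hzU : z ∉ U := by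
        have := hz.2
        rwa [hUo.interior_eq] at this
      have hGz : ‖G z‖ ^ k ≤ Real.exp (k * a) := by
        rw [Real.exp_nat_mul]
        exact pow_le_pow_left₀ (norm_nonneg _) (h1 z hzc.1) k
      have hKn : ‖K z‖ = ‖G z‖ ^ k * ‖(z + ((L + 2 * e : ℝ) : ℂ)) / (z - (L : ℂ))‖ ^ n := by
        simp only [hK, norm_mul, norm_pow]
      have hpos : 0 < ‖z - (L : ℂ)‖ := lt_of_lt_of_le hb hzc.2.1
      have hnum : ‖z + ((L + 2 * e : ℝ) : ℂ)‖ ≤ ‖z - (L : ℂ)‖ + (2 * L + 2 * e) := by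
        have e1 : z + ((L + 2 * e : ℝ) : ℂ) = (z - (L : ℂ)) + ((2 * L + 2 * e : ℝ) : ℂ) := by
          push_cast; ring
        rw [e1]
        refine (norm_add_le _ _).trans ?_
        rw [Complex.norm_real, Real.norm_of_nonneg (by positivity)]
      rw [hKn]
      by_cases c1 : z.re = -e
      · have : ‖(z + ((L + 2 * e : ℝ) : ℂ)) / (z - (L : ℂ))‖ = 1 := by
          rw [norm_div, div_eq_one_iff_eq hpos.ne']
          rw [← sq_eq_sq₀ (norm_nonneg _) (norm_nonneg _), Complex.sq_norm, Complex.sq_norm,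
            Complex.normSq_apply, Complex.normSq_apply]
          simp [c1]
          ring
        rw [this, one_pow]
        exact mul_le_mul hGz (one_le_pow₀ hfac) zero_le_one (Real.exp_pos _).le
      by_cases c2 : ‖z - (L : ℂ)‖ = b
      · have hq : ‖(z + ((L + 2 * e : ℝ) : ℂ)) / (z - (L : ℂ))‖ ≤ Q := by
          rw [norm_div, c2]
          refine le_trans ?_ hQ
          rw [c2] at hnum
          gcongr
          linarith
        have hm : ‖G z‖ ^ k ≤ Real.exp (-(k * m)) := by
          rw [← mul_neg, Real.exp_nat_mul]
          exact pow_le_pow_left₀ (norm_nonneg _) (h2 z c2.le) k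
        have hqn : ‖(z + ((L + 2 * e : ℝ) : ℂ)) / (z - (L : ℂ))‖ ^ n ≤ Real.exp (k * m) := by
          refine (pow_le_pow_left₀ (norm_nonneg _) hq n).trans ?_
          refine le_trans ?_ (Real.exp_le_exp.2 hnk)
          rw [Real.exp_nat_mul, Real.exp_log hQ0]
        calc _ ≤ Real.exp (-(k * m)) * Real.exp (k * m) :=
              mul_le_mul hm hqn (by positivity) (by positivity)
          _ = 1 * 1 := by rw [← Real.exp_add]; simp
          _ ≤ _ := mul_le_mul (Real.one_le_exp (by positivity)) (one_le_pow₀ hfac) zero_le_one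
              (Real.exp_pos _).le
      have c3 : ‖z‖ = R := by
        by_contra c3
        exact hzU ⟨lt_of_le_of_ne hzc.1 (Ne.symm c1), lt_of_le_of_ne hzc.2.1 (Ne.symm c2),
          lt_of_le_of_ne hzc.2.2 c3⟩
      refine mul_le_mul hGz (pow_le_pow_left₀ (norm_nonneg _) ?_ n) (by positivity)
        (Real.exp_pos _).le
      have hden : R - L ≤ ‖z - (L : ℂ)‖ := by
        have := norm_sub_norm_le z (L : ℂ)
        rwa [c3, Complex.norm_real, Real.norm_of_nonneg hL.le] at this
      rw [norm_div]
      calc _ ≤ (‖z - (L : ℂ)‖ + (2 * L + 2 * e)) / ‖z - (L : ℂ)‖ := by gcongr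
        _ = 1 + (2 * L + 2 * e) / ‖z - (L : ℂ)‖ := by field_simp
        _ ≤ _ := by
          have : 0 < R - L := by linarith
          gcongr
    have := Complex.norm_le_of_forall_mem_frontier_norm_le hUb hd hbd
      (subset_closure (show s ∈ U from ⟨hs, hsb, hRs⟩))
    simpa only [hK, norm_mul, norm_pow] using this
  simpa using this

theorem key_real (G : ℂ → ℂ) (hG : Differentiable ℂ G) (e L b a m Q : ℝ) (he : 0 < e)
    (hb : 0 < b) (hbL : b < L) (ha : 0 ≤ a) (hm : 0 < m) (hQ : (2 * L + 2 * e + b) / b ≤ Q)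
    (h1 : ∀ s : ℂ, -e ≤ s.re → ‖G s‖ ≤ Real.exp a)
    (h2 : ∀ s : ℂ, ‖s - (L : ℂ)‖ ≤ b → ‖G s‖ ≤ Real.exp (-m))
    (s : ℂ) (hs : -e < s.re) (hsb : b < ‖s - (L : ℂ)‖) (l : ℝ) (hl : 0 ≤ l)
    (hlq : Real.exp l ≤ ‖(s + ((L + 2 * e : ℝ) : ℂ)) / (s - (L : ℂ))‖) :
    ‖G s‖ ≤ Real.exp (a - m / (2 * Real.log Q) * l) := by
  have hL : 0 < L := hb.trans hbL
  have hQ1 : 1 < Q := by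
    refine lt_of_lt_of_le ?_ hQ
    rw [one_lt_div hb]; linarith
  have hlQ : 0 < Real.log Q := Real.log_pos hQ1
  obtain ⟨q, hq1, hq2⟩ := exists_rat_btwn (show m / (2 * Real.log Q) < m / Real.log Q by
    apply div_lt_div_of_pos_left hm hlQ; linarith)
  have hq0 : (0 : ℝ) < q := lt_trans (by positivity) hq1
  have hq0' : 0 < q := by exact_mod_cast hq0
  obtain ⟨n, k, hk, hnk⟩ : ∃ n k : ℕ, 0 < k ∧ (q : ℝ) = n / k := by
    refine ⟨q.num.toNat, q.den, q.den_pos, ?_⟩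
    have h3 : ((q.num.toNat : ℤ) : ℝ) = (q.num : ℝ) := by
      rw [Int.toNat_of_nonneg (Rat.num_nonneg.2 hq0'.le)]
    rw [Rat.cast_def, ← h3, Int.cast_natCast]
  have hk' : (0 : ℝ) < k := by exact_mod_cast hk
  rw [hnk] at hq1 hq2
  have key := key_int G hG e L b a m Q he hb hbL ha hQ h1 h2 n k (by
    rw [div_lt_div_iff₀ hk' hlQ] at hq2
    linarith) s hs hsb
  have h4 : ‖G s‖ ^ k * Real.exp (n * l) ≤ Real.exp (k * a) := by
    refine le_trans ?_ key
    rw [Real.exp_nat_mul]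
    gcongr
  have h5 : ‖G s‖ ^ k ≤ Real.exp (a - m / (2 * Real.log Q) * l) ^ k := by
    rw [← Real.exp_nat_mul]
    calc ‖G s‖ ^ k = ‖G s‖ ^ k * Real.exp (n * l) * Real.exp (-(n * l)) := by
          rw [mul_assoc, ← Real.exp_add]; simp
      _ ≤ Real.exp (k * a) * Real.exp (-(n * l)) := by gcongr
      _ = Real.exp (k * a - n * l) := by rw [← Real.exp_add]; ring_nf
      _ ≤ _ := by
        apply Real.exp_le_exp.2
        have : m / (2 * Real.log Q) * k ≤ n := ((lt_div_iff₀ hk').1 hq1).le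
        nlinarith [mul_le_mul_of_nonneg_right this hl]
  exact le_of_pow_le_pow_left₀ hk.ne' (Real.exp_pos _).le h5

/-- **Propagation of exponential decay by the maximum principle.**
If an entire function `F` satisfies `|F(s)| ≤ e^{Φ(s)/(2h)}` everywhere and the improved
bound `|F(s)| ≤ e^{(Φ(s)-c)/(2h)}` on the disc `|s - L| ≤ b`, then there are `c', δ > 0`,
depending only on `c`, `b`, `L`, `r`, such that `|F(s)| ≤ e^{(Φ(s)-c')/(2h)}` on the strip
`|Re s| ≤ δ`, `|Im s| ≤ r`. -/
theorem propagation_of_smallness (c b L r : ℝ) (hc : 0 < c) (hb : 0 < b) (hbL : b < L)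
    (hr : 0 ≤ r) :
    ∃ c' > (0 : ℝ), ∃ δ > (0 : ℝ),
      ∀ h : ℝ, 0 < h → h ≤ 1 →
      ∀ F : ℂ → ℂ, Differentiable ℂ F →
        (∀ s : ℂ, ‖F s‖ ≤ Real.exp (SBweight s / (2 * h))) →
        (∀ s : ℂ, ‖s - (L : ℂ)‖ ≤ b → ‖F s‖ ≤ Real.exp ((SBweight s - c) / (2 * h))) →
        ∀ s : ℂ, |s.re| ≤ δ → |s.im| ≤ r →
          ‖F s‖ ≤ Real.exp ((SBweight s - c') / (2 * h)) := by
  have hL : 0 < L := hb.trans hbL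
  set Q : ℝ := (2 * L + 2 + b) / b with hQ
  have hQ1 : 1 < Q := by rw [hQ, one_lt_div hb]; linarith
  have hlQ : 0 < Real.log Q := Real.log_pos hQ1
  set D : ℝ := (L + 1) ^ 2 + r ^ 2 with hD
  have hD0 : 0 < D := by positivity
  set κ : ℝ := c / (2 * Real.log Q) * (L / (2 * D)) with hκ
  have hκ0 : 0 < κ := by positivity
  obtain ⟨e, he, he1, he2, he3⟩ : ∃ e : ℝ, 0 < e ∧ e ≤ 1 ∧ e ≤ κ / 2 ∧ e ≤ L - b := by
    refine ⟨min 1 (min (κ / 2) (L - b)), ?_, min_le_left _ _, ?_, ?_⟩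
    · have : 0 < L - b := by linarith
      positivity
    · exact (min_le_right _ _).trans (min_le_left _ _)
    · exact (min_le_right _ _).trans (min_le_right _ _)
  refine ⟨κ * e / 2, by positivity, e / 2, by positivity, ?_⟩
  intro h hh _ F hF hF1 hF2 s hsre hsim
  obtain ⟨hx1, hx2⟩ := abs_le.1 hsre
  set G : ℂ → ℂ := fun z => F z * Complex.exp (z ^ 2 / ((2 * h : ℝ) : ℂ)) with hG
  have hGd : Differentiable ℂ G := by
    intro z
    have := hF z
    simp only [hG, div_eq_mul_inv]
    fun_prop
  have hGn : ∀ z, ‖G z‖ = ‖F z‖ * Real.exp ((z.re ^ 2 - z.im ^ 2) / (2 * h)) := by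
    intro z
    simp only [hG, norm_mul, Complex.norm_exp, Complex.div_ofReal_re]
    congr 3
    simp [sq]
  have hFn : ∀ z, ‖F z‖ = ‖G z‖ * Real.exp ((z.im ^ 2 - z.re ^ 2) / (2 * h)) := by
    intro z
    rw [hGn, mul_assoc, ← Real.exp_add, ← add_div]
    simp
  have h1 : ∀ z : ℂ, -e ≤ z.re → ‖G z‖ ≤ Real.exp (e ^ 2 / (2 * h)) := by
    intro z hz
    rw [hGn]
    refine (mul_le_mul_of_nonneg_right (hF1 z) (Real.exp_pos _).le).trans ?_
    rw [← Real.exp_add, ← add_div]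
    apply Real.exp_le_exp.2
    apply div_le_div_of_nonneg_right _ (by positivity)
    unfold SBweight
    split_ifs with h0
    · nlinarith
    · nlinarith
  have h2 : ∀ z : ℂ, ‖z - (L : ℂ)‖ ≤ b → ‖G z‖ ≤ Real.exp (-(c / (2 * h))) := by
    intro z hz
    rw [hGn]
    refine (mul_le_mul_of_nonneg_right (hF2 z hz) (Real.exp_pos _).le).trans ?_
    rw [← Real.exp_add, ← add_div, ← neg_div]
    apply Real.exp_le_exp.2
    apply div_le_div_of_nonneg_right _ (by positivity)
    have hzr := (abs_le.1 ((Complex.abs_re_le_norm _).trans hz)).1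
    simp only [Complex.sub_re, Complex.ofReal_re] at hzr
    unfold SBweight
    rw [if_neg (by linarith)]
    linarith
  have hsb : b < ‖s - (L : ℂ)‖ := by
    have := (neg_le_abs _).trans (Complex.abs_re_le_norm (s - (L : ℂ)))
    simp only [Complex.sub_re, Complex.ofReal_re] at this
    linarith
  have hlq : Real.exp (e * L / (2 * D)) ≤
      ‖(s + ((L + 2 * e : ℝ) : ℂ)) / (s - (L : ℂ))‖ := by
    have hpos : 0 < ‖s - (L : ℂ)‖ := hb.trans hsb
    rw [norm_div, le_div_iff₀ hpos, ← sq_le_sq₀ (by positivity) (norm_nonneg _), mul_pow,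
      ← Real.exp_nat_mul, Complex.sq_norm, Complex.sq_norm,
            Complex.normSq_apply, Complex.normSq_apply]
    have hexp : Real.exp ((2 : ℕ) * (e * L / (2 * D))) ≤ 1 + 2 * (e * L / D) := by
      have ht0 : 0 ≤ e * L / D := by positivity
      have ht1 : e * L / D ≤ 1 / 2 := by
        rw [div_le_div_iff₀ hD0 two_pos]
        nlinarith [sq_nonneg r, sq_nonneg (L - 1)]
      have e1 : ((2 : ℕ) : ℝ) * (e * L / (2 * D)) = e * L / D := by
        push_cast; field_simp
      rw [e1]
      have := Real.abs_exp_sub_one_sub_id_le (x := e * L / D) (by rw [abs_le]; constructor <;> linarith)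
      have := (abs_le.1 this).2
      nlinarith
    have hN : (s.re - L) ^ 2 + s.im ^ 2 ≤ D := by
      have : s.im ^ 2 ≤ r ^ 2 := sq_le_sq.2 (by rwa [abs_of_nonneg hr])
      have : (s.re - L) ^ 2 ≤ (L + 1) ^ 2 := by
        apply sq_le_sq.2
        rw [abs_of_nonneg (show 0 ≤ L + 1 by linarith), abs_le]
        constructor <;> linarith
      linarith
    simp only [Complex.sub_re, Complex.ofReal_re, Complex.add_re, Complex.sub_im, Complex.add_im,
      Complex.ofReal_im, sub_zero, add_zero]
    have hN' : e * L / D * ((s.re - L) ^ 2 + s.im ^ 2) ≤ e * L := by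
      calc _ ≤ e * L / D * D := by gcongr
        _ = e * L := by field_simp
    refine (mul_le_mul_of_nonneg_right hexp
      (add_nonneg (mul_self_nonneg _) (mul_self_nonneg _))).trans ?_
    nlinarith [mul_nonneg (show 0 ≤ s.re + e / 2 by linarith) (show 0 ≤ L + e by linarith),
      mul_pos he he]
  have key := key_real G hGd e L b (e ^ 2 / (2 * h)) (c / (2 * h)) Q he hb hbL (by positivity)
    (by positivity) (by rw [hQ]; gcongr; linarith) h1 h2 s (by linarith) hsb _ (by positivity) hlq
  rw [hFn]
  refine (mul_le_mul_of_nonneg_right key (Real.exp_pos _).le).trans ?_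
  rw [← Real.exp_add]
  apply Real.exp_le_exp.2
  have e2 : c / (2 * h) / (2 * Real.log Q) * (e * L / (2 * D)) = κ * e / (2 * h) := by
    rw [hκ]; field_simp
  rw [e2, ← sub_div, ← add_div]
  apply div_le_div_of_nonneg_right _ (by positivity)
  unfold SBweight
  split_ifs with h0
  · nlinarith [sq_nonneg s.re]
  · nlinarith
end
end

section
/- Let f ∈ L^∞(ℝⁿ) have compact support and let U ⊂ ℝⁿ be an open set. Suppose there exist constants C > 0 and c' > 0 such that for every h ∈ (0,1] and every x ∈ U the Segal–Bargmann transform satisfies |Tf(x)| ≤ C h^{−1} e^{−c'/(2h)} (here x is regarded as a point of ℂⁿ with zero imaginary part). Then f = 0 almost everywhere on U. -/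
open MeasureTheory Real

noncomputable section

open Filter Topology

/-- Gaussian kernel. -/
def sbK {n : ℕ} (c : ℝ) (v w : EuclideanSpace ℝ (Fin n)) : ℂ :=
  ((π * c : ℂ) ^ (Module.finrank ℝ (EuclideanSpace ℝ (Fin n)) / 2 : ℂ) *
    Complex.exp (-π ^ 2 * c * ‖v - w‖ ^ 2))

lemma sbK_cont {n : ℕ} (c : ℝ) :
    Continuous (fun p : EuclideanSpace ℝ (Fin n) × EuclideanSpace ℝ (Fin n) => sbK c p.1 p.2) := by
  unfold sbK
  fun_prop

lemma sbK_norm {n : ℕ} (c : ℝ) (hc : 0 < c) (v w : EuclideanSpace ℝ (Fin n)) :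
    ‖sbK c v w‖ = (π * c) ^ ((n : ℝ) / 2) * Real.exp (-(π ^ 2 * c) * ‖v - w‖ ^ 2) := by
  unfold sbK
  rw [norm_mul, Complex.norm_exp]
  congr 1
  · have : ((π : ℂ) * c) = ((π * c : ℝ) : ℂ) := by push_cast; rfl
    rw [this, Complex.norm_cpow_eq_rpow_re_of_pos (by positivity)]
    simp
  · have : (-(π:ℂ) ^ 2 * c * (‖v - w‖:ℂ) ^ 2) = ((-(π ^ 2 * c) * ‖v - w‖ ^ 2 : ℝ) : ℂ) := by
      push_cast; ring
    rw [this, Complex.ofReal_re]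

lemma sbK_norm_le {n : ℕ} (c : ℝ) (hc : 0 < c) (v w : EuclideanSpace ℝ (Fin n)) :
    ‖sbK c v w‖ ≤ (π * c) ^ ((n : ℝ) / 2) := by
  rw [sbK_norm c hc]
  have : Real.exp (-(π ^ 2 * c) * ‖v - w‖ ^ 2) ≤ 1 := by
    rw [Real.exp_le_one_iff]
    have : 0 ≤ (π ^ 2 * c) * ‖v - w‖ ^ 2 := by positivity
    linarith
  have h2 : 0 ≤ (π * c) ^ ((n : ℝ) / 2) := by positivity
  nlinarith

lemma sbK_int_norm {n : ℕ} (c : ℝ) (hc : 0 < c) (v : EuclideanSpace ℝ (Fin n)) :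
    ∫ w, ‖sbK c v w‖ = 1 := by
  simp_rw [sbK_norm c hc]
  rw [integral_const_mul,
    integral_sub_left_eq_self (fun w => Real.exp (-(π ^ 2 * c) * ‖w‖ ^ 2)) volume v,
    GaussianFourier.integral_rexp_neg_mul_sq_norm (by positivity)]
  have hpi := Real.pi_pos
  rw [finrank_euclideanSpace_fin, ← Real.mul_rpow (by positivity) (by positivity)]
  have : π * c * (π / (π ^ 2 * c)) = 1 := by field_simp
  rw [this, Real.one_rpow]

lemma sbK_integrable {n : ℕ} (c : ℝ) (hc : 0 < c) (v : EuclideanSpace ℝ (Fin n)) :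
    Integrable (fun w => sbK c v w) := by
  have h : Integrable (fun w => ‖sbK c v w‖) := by
    by_contra h
    have h1 := sbK_int_norm c hc v
    rw [integral_undef h] at h1
    exact zero_ne_one h1
  have hm : Continuous (fun w => sbK c v w) :=
    Continuous.comp (g := fun p : EuclideanSpace ℝ (Fin n) × EuclideanSpace ℝ (Fin n) =>
      sbK c p.1 p.2) (f := fun w => (v, w)) (sbK_cont c) (by fun_prop)
  exact (integrable_norm_iff hm.aestronglyMeasurable).1 h

lemma sbK_sb {n : ℕ} (c : ℝ) (hc : 0 < c) (f : EuclideanSpace ℝ (Fin n) → ℂ)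
    (w : EuclideanSpace ℝ (Fin n)) :
    ∫ v, sbK c v w * f v =
      (π * c : ℂ) ^ (Module.finrank ℝ (EuclideanSpace ℝ (Fin n)) / 2 : ℂ) *
      SegalBargmann (1 / (2 * π ^ 2 * c)) f (WithLp.toLp 2 (fun j => ((w j : ℝ) : ℂ))) := by
  unfold SegalBargmann sbK
  rw [← integral_const_mul]
  congr 1
  ext v
  rw [mul_assoc]
  congr 3
  have h1 : ((‖v - w‖ : ℂ)) ^ 2 = ∑ j, ((w j : ℂ) - (v j : ℂ)) ^ 2 := by
    have := EuclideanSpace.real_norm_sq_eq (v - w)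
    rw [← Complex.ofReal_pow, this]
    push_cast
    refine Finset.sum_congr rfl fun j _ => ?_
    simp
    ring
  rw [h1]
  have hpi : (π : ℂ) ≠ 0 := by exact_mod_cast Real.pi_ne_zero
  have hc0 : (c : ℂ) ≠ 0 := by exact_mod_cast hc.ne'
  simp only
  push_cast
  field_simp

/-- **Exponential smallness of the Segal–Bargmann transform forces vanishing.**
If `f ∈ L^∞(ℝⁿ)` has compact support and `|Tf(x)| ≤ C h⁻¹ e^{-c'/(2h)}` for all real
points `x` of an open set `U` and all `h ∈ (0,1]`, then `f = 0` a.e. on `U`. -/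
theorem segalBargmann_decay_implies_vanishing {n : ℕ}
    (f : EuclideanSpace ℝ (Fin n) → ℂ)
    (hf : MemLp f ⊤ (volume : Measure (EuclideanSpace ℝ (Fin n))))
    (hsupp : HasCompactSupport f)
    (U : Set (EuclideanSpace ℝ (Fin n))) (hU : IsOpen U)
    (C c' : ℝ) (hC : 0 < C) (hc' : 0 < c')
    (hdecay : ∀ h : ℝ, 0 < h → h ≤ 1 → ∀ x ∈ U,
      ‖SegalBargmann h f (WithLp.toLp 2 (fun j => ((x j : ℝ) : ℂ)))‖ ≤ C * h⁻¹ * Real.exp (-c' / (2 * h))) :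
    f =ᵐ[volume.restrict U] 0 := by
  have hloc : LocallyIntegrable f volume := hf.locallyIntegrable (by simp)
  have hint : Integrable f volume :=
    (integrableOn_iff_integrable_of_support_subset (subset_tsupport f)).1
      (hloc.integrableOn_isCompact hsupp)
  have key : ∀ᵐ x ∂(volume : Measure (EuclideanSpace ℝ (Fin n))), x ∈ U → f x = 0 := by
    refine hU.ae_eq_zero_of_integral_contDiff_smul_eq_zero (hloc.locallyIntegrableOn U) ?_
    intro g hg hgs hgU
    have hgc : Continuous (fun w => (g w : ℂ)) := Complex.continuous_ofReal.comp hg.continuous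
    have hgi : Integrable (fun w => (g w : ℂ)) volume :=
      (hg.continuous.integrable_of_hasCompactSupport hgs).ofReal
    obtain ⟨M, hM⟩ := hgs.exists_bound_of_continuous hg.continuous
    have hM0 : 0 ≤ M := (norm_nonneg _).trans (hM 0)
    -- first limit
    have L1 : Tendsto (fun c : ℝ => ∫ v, (∫ w, sbK c v w * (g w : ℂ)) * f v) atTop
        (𝓝 (∫ v, (g v : ℂ) * f v)) := by
      refine tendsto_integral_filter_of_dominated_convergence (fun v => M * ‖f v‖) ?_ ?_
        (hint.norm.const_mul M) ?_
      · refine Eventually.of_forall fun c => ?_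
        refine AEStronglyMeasurable.mul ?_ hint.aestronglyMeasurable
        have : Continuous (fun p : EuclideanSpace ℝ (Fin n) × EuclideanSpace ℝ (Fin n) =>
            sbK c p.1 p.2 * (g p.2 : ℂ)) := (sbK_cont c).mul (hgc.comp continuous_snd)
        exact (this.stronglyMeasurable.integral_prod_right' (ν := volume)).aestronglyMeasurable
      · filter_upwards [eventually_gt_atTop 0] with c hc
        refine Eventually.of_forall fun v => ?_
        rw [norm_mul]
        gcongr
        calc ‖∫ w, sbK c v w * (g w : ℂ)‖ ≤ ∫ w, ‖sbK c v w‖ * M := by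
              refine norm_integral_le_of_norm_le ((sbK_integrable c hc v).norm.mul_const M) ?_
              refine Eventually.of_forall fun w => ?_
              rw [norm_mul, Complex.norm_real]
              gcongr
              exact hM w
          _ = M := by rw [integral_mul_const, sbK_int_norm c hc, one_mul]
      · refine Eventually.of_forall fun v => ?_
        refine Tendsto.mul_const _ ?_
        exact Real.tendsto_integral_gaussian_smul' hgi hgc.continuousAt
    -- Fubini
    have F : ∀ c : ℝ, 0 < c → ∫ v, (∫ w, sbK c v w * (g w : ℂ)) * f v =
        ∫ w, (g w : ℂ) * ∫ v, sbK c v w * f v := by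
      intro c hc
      have hI : Integrable (Function.uncurry fun v w => (sbK c v w * (g w : ℂ)) * f v)
          ((volume : Measure (EuclideanSpace ℝ (Fin n))).prod volume) := by
        have h1 := (hint.mul_prod hgi).bdd_mul (c := (π * c) ^ ((n : ℝ) / 2))
          (sbK_cont (n := n) c).aestronglyMeasurable
          (Eventually.of_forall fun p => sbK_norm_le c hc p.1 p.2)
        refine h1.congr (Eventually.of_forall fun p => ?_)
        simp only [Function.uncurry]
        ring
      simp_rw [← integral_mul_const, ← integral_const_mul]
      rw [integral_integral_swap hI]
      congr 1; ext w; congr 1; ext v; ring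
    -- second limit
    have L2 : Tendsto (fun c : ℝ => ∫ v, (∫ w, sbK c v w * (g w : ℂ)) * f v) atTop (𝓝 0) := by
      have hb := tendsto_rpow_mul_exp_neg_mul_atTop_nhds_zero ((n : ℝ) / 2 + 1) (c' * π ^ 2)
        (by positivity)
      have hb2 := hb.const_mul ((∫ w, ‖(g w : ℂ)‖) * (π ^ ((n : ℝ) / 2) * (C * (2 * π ^ 2))))
      rw [mul_zero] at hb2
      refine squeeze_zero_norm' ?_ hb2
      filter_upwards [eventually_ge_atTop 1] with c hc1
      have hc : 0 < c := by linarith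
      have hpi := Real.pi_pos
      rw [F c hc]
      have hh1 : 1 / (2 * π ^ 2 * c) ≤ 1 := by
        rw [div_le_one (by positivity)]
        have : (1:ℝ) ≤ π ^ 2 := by nlinarith [Real.pi_gt_three]
        nlinarith
      have bd : ∀ w, ‖(g w : ℂ) * ∫ v, sbK c v w * f v‖ ≤ ‖(g w : ℂ)‖ *
          ((π * c) ^ ((n : ℝ) / 2) *
            (C * (1 / (2 * π ^ 2 * c))⁻¹ * Real.exp (-c' / (2 * (1 / (2 * π ^ 2 * c)))))) := by
        intro w
        rw [norm_mul]
        by_cases hw : w ∈ U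
        · gcongr
          rw [sbK_sb c hc, norm_mul]
          have hn : ‖(π * c : ℂ) ^ (Module.finrank ℝ (EuclideanSpace ℝ (Fin n)) / 2 : ℂ)‖
              = (π * c) ^ ((n : ℝ) / 2) := by
            have : ((π : ℂ) * c) = ((π * c : ℝ) : ℂ) := by push_cast; rfl
            rw [this, Complex.norm_cpow_eq_rpow_re_of_pos (by positivity)]
            simp
          rw [hn]
          gcongr
          exact hdecay _ (by positivity) hh1 w hw
        · have : g w = 0 := image_eq_zero_of_notMem_tsupport fun h => hw (hgU h)
          simp [this]
      refine (norm_integral_le_of_norm_le (hgi.norm.mul_const _) (Eventually.of_forall bd)).trans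
        (le_of_eq ?_)
      rw [integral_mul_const, Real.mul_rpow hpi.le hc.le, Real.rpow_add hc, Real.rpow_one]
      have e1 : (1 / (2 * π ^ 2 * c))⁻¹ = 2 * π ^ 2 * c := by field_simp
      have e2 : -c' / (2 * (1 / (2 * π ^ 2 * c))) = -(c' * π ^ 2) * c := by field_simp
      rw [e1, e2]
      ring
    have := tendsto_nhds_unique L1 L2
    simpa [Complex.real_smul] using this
  exact (ae_restrict_iff' hU.measurableSet).2 key

end
end

section
/- (Kashiwara's Watermelon theorem, for bounded functions.) Let f ∈ L^∞(ℝⁿ) have compact support and be supported in a closed half-space H = {x ∈ ℝⁿ : (x − x₀)·ν ≤ 0}, where ν ∈ ℝⁿ is a unit vector and x₀ ∈ ∂H. If (x₀, ξ₀) belongs to the analytic wave front set WF_a(f), then for every t ∈ ℝ such that ξ₀ + tν ≠ 0, the covector (x₀, ξ₀ + tν) also belongs to WF_a(f). -/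
open MeasureTheory Real

noncomputable section

/-- The analytic wave front set of `f`, characterized via exponential decay of the
Segal–Bargmann transform of localizations of `f`: `(x₀, ξ₀) ∉ WF_a(f)` iff there exist an
open neighbourhood `V` of `z₀ = x₀ - iξ₀` in `ℂⁿ`, a cutoff `χ ∈ C_c^∞` with `χ(x₀) = 1`,
and `c, C > 0` with `|T(χf)(z)| ≤ C e^{-c/h + |Im z|²/(2h)}` for `z ∈ V`, `h ∈ (0,1]`. -/
def analyticWaveFrontSet {n : ℕ} (f : EuclideanSpace ℝ (Fin n) → ℂ) :
    Set (EuclideanSpace ℝ (Fin n) × EuclideanSpace ℝ (Fin n)) :=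
  {p | p.2 ≠ 0 ∧
    ¬ ∃ (V : Set (EuclideanSpace ℂ (Fin n))) (χ : EuclideanSpace ℝ (Fin n) → ℝ) (c C : ℝ),
      IsOpen V ∧ WithLp.toLp 2 (fun j => ((p.1 j : ℂ) - Complex.I * (p.2 j : ℂ))) ∈ V ∧
      ContDiff ℝ (⊤ : ℕ∞) χ ∧ HasCompactSupport χ ∧ χ p.1 = 1 ∧ 0 < c ∧ 0 < C ∧
      ∀ h : ℝ, 0 < h → h ≤ 1 → ∀ z ∈ V,
        ‖SegalBargmann h (fun y => (χ y : ℂ) * f y) z‖ ≤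
          C * Real.exp (-c / h + (∑ j, (z j).im ^ 2) / (2 * h))}

def wmM (c lam ε b₁ B : ℝ) (s : ℂ) : ℝ :=
  c / 2 * Real.sin (lam * (s.re + ε)) * Real.sinh (lam * (s.im - B)) / Real.sinh (lam * (b₁ - B))

lemma wm_core (G : ℂ → ℂ) (hG : Differentiable ℂ G) (h N K c L ε b₁ B : ℝ) (hh : 0 < h)
    (hK : 0 ≤ K) (hc : 0 < c) (hε : 0 < ε) (hεL : ε ≤ L) (hL : L ^ 2 ≤ c) (hB : b₁ ≠ B)
    (h1 : ∀ s, ‖G s‖ ≤ K * Real.exp ((N + s.im ^ 2 - (max s.re 0) ^ 2) / (2 * h)))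
    (h2 : ∀ s : ℂ, s.im = b₁ → |s.re| ≤ L →
      ‖G s‖ ≤ K * Real.exp (-c / h + (N + s.im ^ 2) / (2 * h)))
    (s : ℂ) (hs1 : -ε < s.re) (hs2 : s.re < L) (hs3 : min b₁ B < s.im) (hs4 : s.im < max b₁ B) :
    ‖G s‖ ≤ K * Real.exp ((N + s.im ^ 2) / (2 * h) +
      (ε ^ 2 / 2 - wmM c (π / (L + ε)) ε b₁ B s) / h) := by
  set lam := π / (L + ε) with hlam
  have hLe : 0 < L + ε := by linarith
  have hlam0 : 0 < lam := div_pos Real.pi_pos hLe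
  have hlamL : lam * (L + ε) = π := by rw [hlam]; field_simp
  have hsh : Real.sinh (lam * (b₁ - B)) ≠ 0 := by
    rw [Real.sinh_ne_zero]; exact mul_ne_zero hlam0.ne' (sub_ne_zero.2 hB)
  set κ : ℝ := c / 2 / Real.sinh (lam * (b₁ - B)) with hκ
  let E : ℂ → ℂ := fun s => (s ^ 2 / 2 + Complex.I * κ * Complex.cos (lam * (s + ε - Complex.I * B))) / h
  have hE : ∀ s, (E s).re = ((s.re ^ 2 - s.im ^ 2) / 2 + wmM c lam ε b₁ B s) / h := by
    intro s
    simp only [E]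
    rw [Complex.div_ofReal_re, Complex.cos_eq]
    have e1 : ((lam : ℂ) * (s + ε - Complex.I * B)).re = lam * (s.re + ε) := by simp
    have e2 : ((lam : ℂ) * (s + ε - Complex.I * B)).im = lam * (s.im - B) := by simp
    rw [e1, e2, ← Complex.ofReal_sin, ← Complex.ofReal_cos, ← Complex.ofReal_sinh,
      ← Complex.ofReal_cosh]
    have e3 : (s ^ 2 / 2).re = (s.re ^ 2 - s.im ^ 2) / 2 := by
      rw [show (2 : ℂ) = ((2 : ℝ) : ℂ) by simp, Complex.div_ofReal_re]
      simp [pow_two]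
    rw [Complex.add_re, e3]
    congr 2
    simp only [Complex.mul_re, Complex.mul_im, Complex.sub_re, Complex.sub_im, Complex.I_re,
      Complex.I_im, Complex.ofReal_re, Complex.ofReal_im, wmM, hκ]
    ring
  let P : ℂ → ℂ := fun s => G s * Complex.exp (E s)
  have hP : ∀ s, ‖P s‖ = ‖G s‖ * Real.exp (((s.re ^ 2 - s.im ^ 2) / 2 + wmM c lam ε b₁ B s) / h) := by
    intro s
    simp only [P]; rw [norm_mul, Complex.norm_exp, hE]
  have hPd : Differentiable ℂ P := by
    have : Differentiable ℂ E := by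
      simp only [E]
      fun_prop
    exact hG.mul this.cexp
  have key1 : ∀ s : ℂ, -ε ≤ s.re → wmM c lam ε b₁ B s = 0 → ‖P s‖ ≤ K * Real.exp ((N + ε ^ 2) / (2 * h)) := by
    intro s hs hM
    rw [hP, hM]
    refine (mul_le_mul_of_nonneg_right (h1 s) (Real.exp_pos _).le).trans ?_
    rw [mul_assoc, ← Real.exp_add]
    gcongr
    rw [add_zero, div_div, ← add_div]
    refine div_le_div_of_nonneg_right ?_ (by positivity)
    have : s.re ^ 2 - max s.re 0 ^ 2 ≤ ε ^ 2 := by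
      rcases le_total s.re 0 with h0 | h0
      · rw [max_eq_right h0]; nlinarith
      · rw [max_eq_left h0]; nlinarith
    linarith
  have key2 : ∀ s : ℂ, -ε ≤ s.re → s.re ≤ L → s.im = b₁ → ‖P s‖ ≤ K * Real.exp ((N + ε ^ 2) / (2 * h)) := by
    intro s hs hsL hb
    rw [hP]
    refine (mul_le_mul_of_nonneg_right (h2 s hb (abs_le.2 ⟨by linarith, hsL⟩)) (Real.exp_pos _).le).trans ?_
    rw [mul_assoc, ← Real.exp_add]
    gcongr
    have hM : wmM c lam ε b₁ B s ≤ c / 2 := by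
      unfold wmM
      rw [hb, mul_div_assoc, div_self hsh, mul_one]
      nlinarith [Real.sin_le_one (lam * (s.re + ε))]
    have : -c / h + (N + s.im ^ 2) / (2 * h) + ((s.re ^ 2 - s.im ^ 2) / 2 + wmM c lam ε b₁ B s) / h
      = (-2 * c + N + s.re ^ 2 + 2 * wmM c lam ε b₁ B s) / (2 * h) := by field_simp; ring
    rw [this]
    refine div_le_div_of_nonneg_right ?_ (by positivity)
    have : s.re ^ 2 ≤ L ^ 2 := sq_le_sq' (by linarith) hsL
    nlinarith
  have hmm : min b₁ B < max b₁ B := hs3.trans hs4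
  have hmain : ‖P s‖ ≤ K * Real.exp ((N + ε ^ 2) / (2 * h)) := by
    refine Complex.norm_le_of_forall_mem_frontier_norm_le
      (U := Set.Ioo (-ε) L ×ℂ Set.Ioo (min b₁ B) (max b₁ B))
      ((Metric.isBounded_Ioo _ _).reProdIm (Metric.isBounded_Ioo _ _)) hPd.diffContOnCl ?_
      (subset_closure ⟨⟨hs1, hs2⟩, ⟨hs3, hs4⟩⟩)
    intro z hz
    rw [Complex.frontier_reProdIm, closure_Ioo (by linarith), closure_Ioo hmm.ne,
      frontier_Ioo hmm, frontier_Ioo (by linarith)] at hz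
    rcases hz with ⟨⟨ha, hb⟩, hi⟩ | ⟨hr, -⟩
    · have : z.im = b₁ ∨ z.im = B := by
        rcases le_total b₁ B with h | h
        · simpa [h] using hi
        · simpa [h, or_comm] using hi
      rcases this with h | h
      · exact key2 z ha hb h
      · exact key1 z ha (by simp [wmM, h])
    · rcases hr with h | h
      · have h : z.re = -ε := h
        exact key1 z h.ge (by simp [wmM, h])
      · have h : z.re = L := h
        exact key1 z (by linarith) (by simp [wmM, h, hlamL])
  rw [hP] at hmain
  rw [← le_div_iff₀ (Real.exp_pos _), mul_div_assoc, ← Real.exp_sub] at hmain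
  refine hmain.trans ?_
  gcongr
  rw [← sub_nonneg]
  have : (N + s.im ^ 2) / (2 * h) + (ε ^ 2 / 2 - wmM c lam ε b₁ B s) / h - ((N + ε ^ 2) / (2 * h) -
      ((s.re ^ 2 - s.im ^ 2) / 2 + wmM c lam ε b₁ B s) / h) = s.re ^ 2 / (2 * h) := by
    field_simp; ring
  rw [this]; positivity

lemma wm_pos (c L ε b₁ b₀ : ℝ) (hc : 0 < c) (hε : 0 < ε) (hεL : ε ≤ L) (hb : b₁ ≠ b₀)
    (hsm : ε * (2 * L * Real.cosh (π / L * (b₁ - b₀))) < c) (s : ℂ) (h0 : s.re = 0) (hi : s.im = b₀) :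
    ε ^ 2 / 2 < wmM c (π / (L + ε)) ε b₁ (2 * b₀ - b₁) s := by
  have hL : 0 < L := by linarith
  have hLe : 0 < L + ε := by linarith
  set lam := π / (L + ε) with hlam
  have hlam0 : 0 < lam := div_pos Real.pi_pos hLe
  set y := lam * (b₁ - b₀) with hy
  have hy0 : Real.sinh y ≠ 0 := by
    rw [Real.sinh_ne_zero]; exact mul_ne_zero hlam0.ne' (sub_ne_zero.2 hb)
  have hch := Real.cosh_pos y
  have hM : wmM c lam ε b₁ (2 * b₀ - b₁) s = c / 4 * Real.sin (lam * ε) / Real.cosh y := by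
    unfold wmM
    rw [h0, hi, show lam * (b₀ - (2 * b₀ - b₁)) = y by rw [hy]; ring,
      show lam * (b₁ - (2 * b₀ - b₁)) = 2 * y by rw [hy]; ring, Real.sinh_two_mul, zero_add]
    field_simp; ring
  have hc1 : Real.cosh y ≤ Real.cosh (π / L * (b₁ - b₀)) := by
    rw [Real.cosh_le_cosh, hy, abs_mul, abs_mul, abs_of_pos hlam0, abs_of_pos (div_pos Real.pi_pos hL)]
    refine mul_le_mul_of_nonneg_right ?_ (abs_nonneg _)
    exact div_le_div_of_nonneg_left Real.pi_pos.le hL (by linarith)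
  have hsin : ε / L ≤ Real.sin (lam * ε) := by
    have h3 : lam * ε ≤ π / 2 := by
      rw [hlam, div_mul_eq_mul_div, div_le_div_iff₀ hLe (by norm_num)]
      nlinarith [Real.pi_pos]
    refine le_trans ?_ (Real.mul_le_sin (by positivity) h3)
    rw [hlam]
    have : 2 / π * (π / (L + ε) * ε) = 2 * ε / (L + ε) := by
      field_simp
    rw [this, div_le_div_iff₀ hL hLe]
    nlinarith
  rw [hM]
  rw [lt_div_iff₀ hch]
  have a1 : ε * (2 * L * Real.cosh y) < c := lt_of_le_of_lt (by gcongr) hsm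
  have a2 : c / 4 * (ε / L) ≤ c / 4 * Real.sin (lam * ε) := by gcongr
  refine lt_of_lt_of_le ?_ a2
  rw [← mul_div_assoc, lt_div_iff₀ hL]
  nlinarith

lemma sb_bound {n : ℕ} (g : EuclideanSpace ℝ (Fin n) → ℂ) (hg : Integrable g)
    (x₀ ν : EuclideanSpace ℝ (Fin n)) (hν : ∑ j, ν j ^ 2 = 1)
    (hsupp : ∀ y, g y ≠ 0 → ∑ j, (y j - x₀ j) * ν j ≤ 0) (h : ℝ) (hh : 0 < h)
    (z : EuclideanSpace ℂ (Fin n)) (a : ℝ) (ha : a = ∑ j, ((z j).re - x₀ j) * ν j) :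
    ‖SegalBargmann h g z‖ ≤ (∫ y, ‖g y‖) *
      Real.exp ((∑ j, (z j).im ^ 2 - (max a 0) ^ 2) / (2 * h)) := by
  unfold SegalBargmann
  rw [mul_comm (∫ y, ‖g y‖), ← integral_const_mul]
  refine norm_integral_le_of_norm_le (hg.norm.const_mul _) (Filter.Eventually.of_forall fun y => ?_)
  by_cases hy : g y = 0
  · simp [hy]
  rw [norm_mul, Complex.norm_exp]
  gcongr
  rw [show (2 * (h : ℂ)) = ((2 * h : ℝ) : ℂ) by simp, Complex.div_ofReal_re]
  refine div_le_div_of_nonneg_right ?_ (by positivity)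
  have e : (-∑ j, (z j - (y j : ℂ)) ^ 2).re = ∑ j, (z j).im ^ 2 - ∑ j, ((z j).re - y j) ^ 2 := by
    rw [Complex.neg_re, Complex.re_sum, ← Finset.sum_sub_distrib, ← Finset.sum_neg_distrib]
    refine Finset.sum_congr rfl fun j _ => ?_
    simp [pow_two]
  rw [e]
  refine sub_le_sub_left ?_ _
  have hcs := Finset.sum_mul_sq_le_sq_mul_sq Finset.univ (fun j => (z j).re - y j) (fun j => ν j)
  rw [hν, mul_one] at hcs
  refine le_trans ?_ hcs
  have e2 : ∑ j, ((z j).re - y j) * ν j = a - ∑ j, (y j - x₀ j) * ν j := by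
    rw [ha, ← Finset.sum_sub_distrib]
    exact Finset.sum_congr rfl fun j _ => by ring
  rw [e2]
  have := hsupp y hy
  rcases le_total a 0 with h0 | h0
  · rw [max_eq_right h0]; nlinarith [sq_nonneg (a - ∑ j, (y j - x₀ j) * ν j)]
  · rw [max_eq_left h0]; nlinarith

lemma sb_diff {n : ℕ} (g : EuclideanSpace ℝ (Fin n) → ℂ) (hg : Integrable g)
    (hgc : HasCompactSupport g) (h : ℝ) (u v : Fin n → ℂ) :
    Differentiable ℂ (fun w : ℂ => SegalBargmann h g (WithLp.toLp 2 fun j => u j + w * v j)) := by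
  intro w₀
  unfold SegalBargmann
  let E : ℂ → EuclideanSpace ℝ (Fin n) → ℂ := fun w y =>
    Complex.exp (-(∑ j, (u j + w * v j - (y j : ℂ)) ^ 2) / (2 * h))
  let D : ℂ → EuclideanSpace ℝ (Fin n) → ℂ := fun w y =>
    -(∑ j, 2 * (u j + w * v j - (y j : ℂ)) * v j) / (2 * h)
  have hEc : Continuous (fun p : ℂ × EuclideanSpace ℝ (Fin n) => E p.1 p.2) := by
    simp only [E]; fun_prop
  have hDc : Continuous (fun p : ℂ × EuclideanSpace ℝ (Fin n) => D p.1 p.2) := by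
    simp only [D]; fun_prop
  have hEd : ∀ w y, HasDerivAt (fun w => E w y) (E w y * D w y) w := by
    intro w y
    simp only [E, D]
    refine HasDerivAt.cexp ?_
    refine HasDerivAt.div_const ?_ _
    refine HasDerivAt.neg ?_
    refine HasDerivAt.fun_sum fun j _ => ?_
    have h1 : HasDerivAt (fun w => u j + w * v j - (y j : ℂ)) (v j) w := by
      simpa using (((hasDerivAt_id w).mul_const (v j)).const_add (u j)).sub_const (y j : ℂ)
    simpa using h1.fun_pow 2
  obtain ⟨M, hM⟩ := ((isCompact_closedBall w₀ 1).prod hgc).exists_bound_of_continuousOn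
    (hEc.mul hDc).continuousOn
  have hmeas : ∀ k : EuclideanSpace ℝ (Fin n) → ℂ, Continuous k →
      Integrable (fun y => k y * g y) := by
    intro k hk
    obtain ⟨M', hM'⟩ := (show IsCompact (tsupport g) from hgc).exists_bound_of_continuousOn
      hk.continuousOn
    refine (hg.norm.const_mul M').mono' (hk.aestronglyMeasurable.mul hg.1)
      (Filter.Eventually.of_forall fun y => ?_)
    by_cases hy : g y = 0
    · simp [hy]
    rw [norm_mul]
    gcongr
    exact hM' y (subset_tsupport _ hy)
  have := hasDerivAt_integral_of_dominated_loc_of_deriv_le (μ := volume) (F := fun w y => E w y * g y)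
    (F' := fun w y => E w y * D w y * g y) (x₀ := w₀) (s := Metric.closedBall w₀ 1)
    (bound := fun y => M * ‖g y‖)
    (Metric.closedBall_mem_nhds _ one_pos)
    (Filter.Eventually.of_forall fun w => (hmeas _ (by fun_prop)).1)
    (hmeas _ (by fun_prop))
    (hmeas _ (by fun_prop)).1
    (Filter.Eventually.of_forall fun y w hw => by
      by_cases hy : g y = 0
      · simp [hy]
      rw [norm_mul]
      gcongr
      exact hM (w, y) ⟨hw, subset_tsupport _ hy⟩)
    (hg.norm.const_mul M)
    (Filter.Eventually.of_forall fun y w hw => (hEd w y).mul_const (g y))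
  exact this.2.differentiableAt

/-- **Kashiwara's Watermelon theorem.**
If a compactly supported `f ∈ L^∞(ℝⁿ)` is supported in the half-space `{(x - x₀)·ν ≤ 0}`
and `(x₀, ξ₀) ∈ WF_a(f)`, then `(x₀, ξ₀ + tν) ∈ WF_a(f)` for every `t ∈ ℝ` with
`ξ₀ + tν ≠ 0`. -/
theorem kashiwara_watermelon {n : ℕ}
    (f : EuclideanSpace ℝ (Fin n) → ℂ)
    (hf : MemLp f ⊤ (volume : Measure (EuclideanSpace ℝ (Fin n))))
    (hcpt : HasCompactSupport f)
    (x₀ ν : EuclideanSpace ℝ (Fin n)) (hν : ‖ν‖ = 1)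
    (hsupp : Function.support f ⊆ {x | ∑ j, (x j - x₀ j) * ν j ≤ 0})
    (ξ₀ : EuclideanSpace ℝ (Fin n)) (hξ₀ : (x₀, ξ₀) ∈ analyticWaveFrontSet f)
    (t : ℝ) (ht : ξ₀ + t • ν ≠ 0) :
    (x₀, ξ₀ + t • ν) ∈ analyticWaveFrontSet f := by
  refine ⟨ht, ?_⟩
  rintro ⟨V, χ, c, C, hVo, hV, hχ, hχc, hχ1, hc, hC, hb⟩
  apply hξ₀.2
  dsimp only at hV hχ1 hb ⊢
  by_cases ht0 : t = 0
  · refine ⟨V, χ, c, C, hVo, ?_, hχ, hχc, hχ1, hc, hC, hb⟩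
    simpa [ht0] using hV
  have hν2 : ∑ j, ν j ^ 2 = 1 := by
    rw [← EuclideanSpace.real_norm_sq_eq, hν]; norm_num
  set g : EuclideanSpace ℝ (Fin n) → ℂ := fun y => (χ y : ℂ) * f y with hgdef
  have hgi : Integrable g := by
    have := (hf.locallyIntegrable le_top).integrable_smul_left_of_hasCompactSupport
      hχ.continuous hχc
    refine this.congr (Filter.Eventually.of_forall fun y => ?_)
    simp [hgdef]
  have hgc : HasCompactSupport g := hcpt.mul_left
  have hgs : ∀ y, g y ≠ 0 → ∑ j, (y j - x₀ j) * ν j ≤ 0 := by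
    intro y hy
    exact hsupp (show f y ≠ 0 from fun h0 => hy (by simp [hgdef, h0]))
  let S : EuclideanSpace ℂ (Fin n) → ℂ := fun z => ∑ j, (z j - (x₀ j : ℂ)) * (ν j : ℂ)
  have hSc : Continuous S := by simp only [S]; fun_prop
  let Z : EuclideanSpace ℂ (Fin n) → ℂ → EuclideanSpace ℂ (Fin n) := fun z s =>
    WithLp.toLp 2 fun j => (z j - S z * (ν j : ℂ)) + s * (ν j : ℂ)
  have hZc : Continuous (fun p : EuclideanSpace ℂ (Fin n) × ℂ => Z p.1 p.2) := by
    simp only [Z]; fun_prop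
  have hZS : ∀ z, Z z (S z) = z := by
    intro z; ext j; simp [Z]
  have hSre : ∀ z, (S z).re = ∑ j, ((z j).re - x₀ j) * ν j := by
    intro z; simp [S, Complex.re_sum]
  have hSim : ∀ z, (S z).im = ∑ j, (z j).im * ν j := by
    intro z; simp [S, Complex.im_sum]
  have hZre : ∀ z s, s.re = ∑ j, ((Z z s j).re - x₀ j) * ν j := by
    intro z s
    have : ∀ j, ((Z z s j).re - x₀ j) * ν j =
        ((z j).re - x₀ j) * ν j + (s.re - (S z).re) * ν j ^ 2 := by
      intro j; simp [Z]; ring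
    simp only [this]
    rw [Finset.sum_add_distrib, ← Finset.mul_sum, hν2, ← hSre]; ring
  have hZim : ∀ z s, ∑ j, (Z z s j).im ^ 2 = (∑ j, (z j).im ^ 2 - (S z).im ^ 2) + s.im ^ 2 := by
    intro z s
    have : ∀ j, (Z z s j).im ^ 2 = (z j).im ^ 2 + 2 * (s.im - (S z).im) * ((z j).im * ν j)
        + (s.im - (S z).im) ^ 2 * ν j ^ 2 := by
      intro j; simp [Z]; ring
    simp only [this]
    rw [Finset.sum_add_distrib, Finset.sum_add_distrib, ← Finset.mul_sum, ← Finset.mul_sum, hν2,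
      ← hSim]; ring
  set z₀ : EuclideanSpace ℂ (Fin n) :=
    WithLp.toLp 2 (fun j => ((x₀ j : ℂ) - Complex.I * (ξ₀ j : ℂ))) with hz₀
  set b₀ : ℝ := -∑ j, ξ₀ j * ν j with hb₀
  set b₁ : ℝ := b₀ - t with hb₁
  have hS0re : (S z₀).re = 0 := by rw [hSre]; simp [hz₀]
  have hS0im : (S z₀).im = b₀ := by rw [hSim]; simp [hz₀, hb₀]
  have hS0 : S z₀ = b₀ * Complex.I := by
    apply Complex.ext <;> simp [hS0re, hS0im]
  have hZ0 : Z z₀ (((0 : ℝ) : ℂ) + b₁ * Complex.I) ∈ V := by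
    convert hV using 1
    ext j
    simp only [Z, hS0]
    simp [hb₁, hz₀]
    ring
  have hpre : IsOpen ((fun p : EuclideanSpace ℂ (Fin n) × ℝ => Z p.1 ((p.2 : ℂ) + b₁ * Complex.I)) ⁻¹' V) := by
    refine hVo.preimage (hZc.comp (f := fun p : EuclideanSpace ℂ (Fin n) × ℝ =>
      (p.1, (p.2 : ℂ) + b₁ * Complex.I)) (by fun_prop))
  obtain ⟨δ, hδ, hball⟩ := Metric.isOpen_iff.1 hpre (z₀, 0) hZ0
  set L := min (δ / 2) (Real.sqrt c) with hLdef
  have hL0 : 0 < L := lt_min (by positivity) (Real.sqrt_pos.2 hc)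
  have hLδ : L < δ := (min_le_left _ _).trans_lt (by linarith)
  have hLc : L ^ 2 ≤ c := by
    calc L ^ 2 ≤ Real.sqrt c ^ 2 := by gcongr; exact min_le_right _ _
      _ = c := Real.sq_sqrt hc.le
  set Q := 2 * L * Real.cosh (π / L * (b₁ - b₀)) with hQ
  have hQ0 : 0 < Q := by have := Real.cosh_pos (π / L * (b₁ - b₀)); positivity
  set ε := min L (c / (2 * Q)) with hεdef
  have hε0 : 0 < ε := lt_min hL0 (by positivity)
  have hεL : ε ≤ L := min_le_left _ _
  have hεQ : ε * Q < c := by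
    calc ε * Q ≤ c / (2 * Q) * Q := by gcongr; exact min_le_right _ _
      _ = c / 2 := by field_simp
      _ < c := by linarith
  have hb01 : b₁ ≠ b₀ := by rw [hb₁]; intro h; apply ht0; linarith
  set B := 2 * b₀ - b₁ with hB
  have hb1B : b₁ ≠ B := by intro h; apply hb01; linarith
  have hpos := wm_pos c L ε b₁ b₀ hc hε0 hεL hb01 hεQ (S z₀) hS0re hS0im
  set M := wmM c (π / (L + ε)) ε b₁ B with hM
  have hMc : Continuous M := by
    simp only [hM]; unfold wmM; fun_prop
  set c' := (M (S z₀) - ε ^ 2 / 2) / 2 with hc'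
  have hc'0 : 0 < c' := by rw [hc']; linarith
  set K := (∫ y, ‖g y‖) + C with hK
  have hint : 0 ≤ ∫ y, ‖g y‖ := integral_nonneg fun _ => norm_nonneg _
  refine ⟨{z | dist z z₀ < δ ∧ -ε < (S z).re ∧ (S z).re < L ∧ min b₁ B < (S z).im ∧
    (S z).im < max b₁ B ∧ ε ^ 2 / 2 + c' < M (S z)}, χ, c', K, ?_, ?_, hχ, hχc, hχ1, hc'0,
    by positivity, ?_⟩
  · have hre := Complex.continuous_re.comp hSc
    have him := Complex.continuous_im.comp hSc
    refine IsOpen.and ?_ <| IsOpen.and ?_ <| IsOpen.and ?_ <| IsOpen.and ?_ <| IsOpen.and ?_ ?_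
    · exact isOpen_lt (by fun_prop) continuous_const
    · exact isOpen_lt continuous_const hre
    · exact isOpen_lt hre continuous_const
    · exact isOpen_lt continuous_const him
    · exact isOpen_lt him continuous_const
    · exact isOpen_lt continuous_const (hMc.comp hSc)
  · refine ⟨by simpa using hδ, by rw [hS0re]; linarith, by rw [hS0re]; linarith, ?_, ?_, ?_⟩
    · rw [hS0im, min_lt_iff]
      rcases lt_or_gt_of_ne hb01 with h | h
      · exact Or.inl h
      · right; linarith
    · rw [hS0im, lt_max_iff]
      rcases lt_or_gt_of_ne hb01 with h | h
      · right; linarith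
      · exact Or.inl h
    · rw [hc']; linarith
  · rintro h hh0 hh1 z ⟨hz1, hz2, hz3, hz4, hz5, hz6⟩
    have := wm_core (fun s => SegalBargmann h g (Z z s))
      (sb_diff g hgi hgc h _ _) h (∑ j, (z j).im ^ 2 - (S z).im ^ 2) K c L ε b₁ B hh0
      (by positivity) hc hε0 hεL hLc hb1B
      (fun s => by
        refine (sb_bound g hgi x₀ ν hν2 hgs h hh0 (Z z s) s.re (hZre z s)).trans ?_
        rw [hZim]
        gcongr
        rw [hK]; linarith)
      (fun s hs hsL => by
        have hsV : Z z s ∈ V := by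
          have h3 : (z, s.re) ∈ Metric.ball (z₀, (0 : ℝ)) δ := by
            rw [Metric.mem_ball, Prod.dist_eq, max_lt_iff]
            exact ⟨hz1, by simpa using hsL.trans_lt hLδ⟩
          have h4 := hball h3
          have h5 : s = (s.re : ℂ) + b₁ * Complex.I := by rw [← hs, Complex.re_add_im]
          rw [h5]; exact h4
        refine (hb h hh0 hh1 _ hsV).trans ?_
        rw [hZim]
        gcongr
        rw [hK]; linarith)
      (S z) hz2 hz3 hz4 hz5
    simp only [hZS] at this
    refine this.trans ?_
    gcongr ?_ * Real.exp ?_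
    rw [sub_add_cancel, add_comm]
    gcongr
    rw [← hM]; linarith

end
end
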